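/- arXiv:math/0607512 — 10 statements merged into one kernel-verified Lean document; each statement's English description precedes it below -/
import Mathlib

section
/- Let G be a finite simple graph, S a set of vertices of G, H the subgraph of G induced on S, and X the set of vertices of S that are adjacent in G to at least one vertex outside S. Suppose that γ(H − V) = γ(H) for every subset V of X. Then every dominating set D of G satisfies |D ∩ S| ≥ γ(H). -/
open SimpleGraph

/-- `D` is a dominating set of `G`. -/
def IsDomSet {V : Type*} (G : SimpleGraph V) (D : Set V) : Prop :=
  ∀ v : V, v ∉ D → ∃ u ∈ D, G.Adj u v

/-- The domination number of `G`. -/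
noncomputable def domNum {V : Type*} (G : SimpleGraph V) : ℕ :=
  sInf {n : ℕ | ∃ D : Set V, IsDomSet G D ∧ D.ncard = n}

/-- A graph is cubic if every vertex has degree three. -/
def IsCubic {V : Type*} (G : SimpleGraph V) : Prop :=
  ∀ v : V, Nat.card (G.neighborSet v) = 3

/-- The graph `A`: `K₃₃` with the edges `u1w1`, `u1w2` subdivided by `a1 = 6`, `a2 = 7`.
Vertices: `u1,u2,u3 = 0,1,2`, `w1,w2,w3 = 3,4,5`, `a1 = 6`, `a2 = 7`. -/
def graphA : SimpleGraph (Fin 8) :=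
  SimpleGraph.fromEdgeSet
    {s(6, 0), s(6, 3), s(7, 0), s(7, 4), s(0, 5),
     s(1, 3), s(1, 4), s(1, 5), s(2, 3), s(2, 4), s(2, 5)}

/-- The graph `B`: `K₃₃` with the edges `u1w1`, `u1w2`, `u1w3` subdivided by
`b1 = 6`, `b2 = 7`, `b3 = 8`. -/
def graphB : SimpleGraph (Fin 9) :=
  SimpleGraph.fromEdgeSet
    {s(6, 0), s(6, 3), s(7, 0), s(7, 4), s(8, 0), s(8, 5),
     s(1, 3), s(1, 4), s(1, 5), s(2, 3), s(2, 4), s(2, 5)}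

/-- Let `G` be a finite simple graph, `S` a set of vertices, `H = G.induce S`
the induced subgraph on `S`, and `X` the set of vertices of `S` adjacent in `G` to at least one
vertex outside `S`.  If `γ(H − V) = γ(H)` for every `V ⊆ X`, then every dominating set `D` of
`G` satisfies `|D ∩ S| ≥ γ(H)`. -/
theorem stmt_0 {VG : Type*} [Fintype VG] (G : SimpleGraph VG) (S : Set VG)
    (X : Set VG) (hX : X = {v | v ∈ S ∧ ∃ u, u ∉ S ∧ G.Adj v u})
    (hdel : ∀ V : Set VG, V ⊆ X → domNum (G.induce (S \ V)) = domNum (G.induce S)) :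
    ∀ D : Set VG, IsDomSet G D → domNum (G.induce S) ≤ (D ∩ S).ncard := by
  intro D hD
  set V : Set VG := {v | v ∈ S ∧ v ∉ D ∧ ∀ u ∈ D, u ∈ S → ¬ G.Adj u v} with hV
  have hVX : V ⊆ X := by
    rintro v ⟨hvS, hvD, hv⟩
    obtain ⟨u, huD, huv⟩ := hD v hvD
    rw [hX]
    exact ⟨hvS, u, fun huS => hv u huD huS huv, huv.symm⟩
  rw [← hdel V hVX]
  have hsub : D ∩ S ⊆ S \ V := fun v hv => ⟨hv.2, fun h => h.2.1 hv.1⟩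
  apply Nat.sInf_le
  refine ⟨{v | (v : VG) ∈ D ∩ S}, ?_, ?_⟩
  · rintro ⟨v, hvS, hvV⟩ hvD
    have hvD' : v ∉ D := fun h => hvD ⟨h, hvS⟩
    by_contra hcon
    refine hvV ⟨hvS, hvD', fun u huD huS huv => hcon ?_⟩
    exact ⟨⟨u, hsub ⟨huD, huS⟩⟩, ⟨huD, huS⟩, huv⟩
  · exact Set.ncard_preimage_of_injective_subset_range Subtype.val_injective
      (by rw [Subtype.range_coe]; exact hsub)
end

section
/- The graph A has 8 vertices, γ(A) = 3, γ(A − a1) = 3, γ(A − a2) = 3, and γ(A − {a1, a2}) = 2. -/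
open SimpleGraph

lemma graphA_adj (x y : Fin 8) : graphA.Adj x y ↔
    (s(x, y) ∈ ({s(6, 0), s(6, 3), s(7, 0), s(7, 4), s(0, 5),
     s(1, 3), s(1, 4), s(1, 5), s(2, 3), s(2, 4), s(2, 5)} : Finset (Sym2 (Fin 8))) ∧ x ≠ y) := by
  simp [graphA]

instance graphA_decAdj : DecidableRel graphA.Adj := fun x y =>
  decidable_of_iff _ (graphA_adj x y).symm

lemma domNum_eq {V : Type*} (G : SimpleGraph V) (k : ℕ)
    (h1 : ∃ D : Set V, IsDomSet G D ∧ D.ncard = k)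
    (h2 : ∀ D : Set V, IsDomSet G D → k ≤ D.ncard) : domNum G = k := by
  apply le_antisymm
  · exact Nat.sInf_le h1
  · apply le_csInf ⟨k, h1⟩
    rintro n ⟨D, hD, rfl⟩
    exact h2 D hD

lemma three_le {V : Type*} [Finite V] [Nonempty V] (G : SimpleGraph V)
    (h : ∀ x y, ∃ v, v ≠ x ∧ v ≠ y ∧ ¬ G.Adj x v ∧ ¬ G.Adj y v)
    (D : Set V) (hD : IsDomSet G D) : 3 ≤ D.ncard := by
  by_contra hlt
  have hsub : ∃ x y, D ⊆ {x, y} := by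
    have hc : D.ncard = 0 ∨ D.ncard = 1 ∨ D.ncard = 2 := by omega
    rcases hc with hc | hc | hc
    · rw [Set.ncard_eq_zero (Set.toFinite D)] at hc
      obtain ⟨x⟩ := ‹Nonempty V›
      exact ⟨x, x, by simp [hc]⟩
    · obtain ⟨x, rfl⟩ := Set.ncard_eq_one.1 hc
      exact ⟨x, x, by simp⟩
    · obtain ⟨x, y, -, rfl⟩ := Set.ncard_eq_two.1 hc
      exact ⟨x, y, subset_rfl⟩
  obtain ⟨x, y, hxy⟩ := hsub
  obtain ⟨v, hx, hy, ax, ay⟩ := h x y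
  have hv : v ∉ D := fun hv => by
    rcases hxy hv with h | h
    · exact hx h
    · exact hy h
  obtain ⟨u, hu, hA⟩ := hD v hv
  rcases hxy hu with rfl | h
  · exact ax hA
  · rw [Set.mem_singleton_iff.1 h] at hA
    exact ay hA

lemma two_le {V : Type*} [Finite V] [Nonempty V] (G : SimpleGraph V)
    (h : ∀ x, ∃ v, v ≠ x ∧ ¬ G.Adj x v)
    (D : Set V) (hD : IsDomSet G D) : 2 ≤ D.ncard := by
  by_contra hlt
  have hsub : ∃ x, D ⊆ {x} := by
    have hc : D.ncard = 0 ∨ D.ncard = 1 := by omega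
    rcases hc with hc | hc
    · rw [Set.ncard_eq_zero (Set.toFinite D)] at hc
      obtain ⟨x⟩ := ‹Nonempty V›
      exact ⟨x, by simp [hc]⟩
    · obtain ⟨x, rfl⟩ := Set.ncard_eq_one.1 hc
      exact ⟨x, subset_rfl⟩
  obtain ⟨x, hxs⟩ := hsub
  obtain ⟨v, hx, ax⟩ := h x
  obtain ⟨u, hu, hA⟩ := hD v (fun hv => hx (hxs hv))
  rw [Set.mem_singleton_iff.1 (hxs hu)] at hA
  exact ax hA

/-- Domination number three of an induced subgraph of `graphA`, reduced to finite checks. -/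
lemma induce_three (S : Set (Fin 8)) (p q r : Fin 8) (hp : p ∈ S) (hq : q ∈ S) (hr : r ∈ S)
    (hpq : p ≠ q) (hpr : p ≠ r) (hqr : q ≠ r)
    (hdom : ∀ v ∈ S, v = p ∨ v = q ∨ v = r ∨ graphA.Adj p v ∨ graphA.Adj q v ∨ graphA.Adj r v)
    (h : ∀ x y, ∃ v ∈ S, v ≠ x ∧ v ≠ y ∧ ¬ graphA.Adj x v ∧ ¬ graphA.Adj y v) :
    domNum (graphA.induce S) = 3 := by
  have : Nonempty S := ⟨⟨p, hp⟩⟩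
  apply domNum_eq
  · refine ⟨{⟨p, hp⟩, ⟨q, hq⟩, ⟨r, hr⟩}, ?_, ?_⟩
    · rintro ⟨v, hv⟩ hn
      have := hdom v hv
      simp at hn ⊢
      tauto
    · exact Set.ncard_eq_three.2 ⟨_, _, _, by simpa using hpq, by simpa using hpr,
        by simpa using hqr, rfl⟩
  · apply three_le
    rintro ⟨x, hx⟩ ⟨y, hy⟩
    obtain ⟨v, hv, h⟩ := h x y
    exact ⟨⟨v, hv⟩, by simpa using h⟩

/-- The graph `A` has 8 vertices, `γ(A) = 3`, `γ(A − a1) = 3`,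
`γ(A − a2) = 3`, and `γ(A − {a1, a2}) = 2` (here `a1 = 6`, `a2 = 7`). -/
theorem stmt_1 :
    Fintype.card (Fin 8) = 8 ∧
    domNum graphA = 3 ∧
    domNum (graphA.induce (({6} : Set (Fin 8))ᶜ)) = 3 ∧
    domNum (graphA.induce (({7} : Set (Fin 8))ᶜ)) = 3 ∧
    domNum (graphA.induce (({6, 7} : Set (Fin 8))ᶜ)) = 2 := by
  refine ⟨by simp, ?_, ?_, ?_, ?_⟩
  · apply domNum_eq
    · refine ⟨{0, 1, 2}, ?_, ?_⟩
      · have h : ∀ v : Fin 8, v ∉ ({0, 1, 2} : Finset (Fin 8)) →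
            ∃ u ∈ ({0, 1, 2} : Finset (Fin 8)), graphA.Adj u v := by decide
        intro v hv
        simpa using h v (by simpa using hv)
      · exact Set.ncard_eq_three.2 ⟨0, 1, 2, by decide, by decide, by decide, rfl⟩
    · exact three_le _ (by decide)
  · apply induce_three _ 0 1 2 <;>
      (try simp only [Set.mem_compl_iff, Set.mem_singleton_iff]) <;> decide
  · apply induce_three _ 0 1 2 <;>
      (try simp only [Set.mem_compl_iff, Set.mem_singleton_iff]) <;> decide
  · have m1 : (1 : Fin 8) ∈ ({6, 7} : Set (Fin 8))ᶜ := by simp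
    have m5 : (5 : Fin 8) ∈ ({6, 7} : Set (Fin 8))ᶜ := by simp
    have : Nonempty ↑(({6, 7} : Set (Fin 8))ᶜ) := ⟨⟨1, m1⟩⟩
    apply domNum_eq
    · refine ⟨{⟨1, m1⟩, ⟨5, m5⟩}, ?_, ?_⟩
      · have h : ∀ v : Fin 8, ¬ (v = 6 ∨ v = 7) →
            v = 1 ∨ v = 5 ∨ graphA.Adj 1 v ∨ graphA.Adj 5 v := by decide
        rintro ⟨v, hv⟩ hn
        have := h v (by simpa using hv)
        simp at hn ⊢
        tauto
      · exact Set.ncard_eq_two.2 ⟨_, _, by simp, rfl⟩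
    · apply two_le
      have h : ∀ x : Fin 8, ∃ v : Fin 8, ¬ (v = 6 ∨ v = 7) ∧ v ≠ x ∧ ¬ graphA.Adj x v := by
        decide
      rintro ⟨x, hx⟩
      obtain ⟨v, hv, h⟩ := h x
      exact ⟨⟨v, by simpa using hv⟩, by simpa using h⟩
end

section
/- The graph B has 9 vertices and γ(B − V) = 3 for every subset V of {b1, b2, b3}. -/
open SimpleGraph

/-- Adjacency in `B` is decidable. -/
instance graphB_decAdj : DecidableRel graphB.Adj := fun a b =>
  decidable_of_iff ((s(a, b) ∈ ([s(6, 0), s(6, 3), s(7, 0), s(7, 4), s(8, 0), s(8, 5),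
     s(1, 3), s(1, 4), s(1, 5), s(2, 3), s(2, 4), s(2, 5)] : List (Sym2 (Fin 9)))) ∧ a ≠ b) (by
    simp only [graphB, SimpleGraph.fromEdgeSet_adj, Set.mem_insert_iff, Set.mem_singleton_iff,
      List.mem_cons, List.not_mem_nil, or_false])

set_option maxRecDepth 100000 in
lemma graphB_no_pair : ∀ a b : Fin 9, ∃ v : Fin 9, v ∉ ({6, 7, 8} : Set (Fin 9)) ∧
    v ≠ a ∧ v ≠ b ∧ ¬ graphB.Adj a v ∧ ¬ graphB.Adj b v := by
  simp only [Set.mem_insert_iff, Set.mem_singleton_iff]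
  decide

set_option maxRecDepth 100000 in
lemma graphB_three (v : Fin 9) : v = 0 ∨ v = 1 ∨ v = 3 ∨
    graphB.Adj 0 v ∨ graphB.Adj 1 v ∨ graphB.Adj 3 v := by
  revert v
  decide

/-- The graph `B` has 9 vertices and `γ(B − V) = 3` for every subset `V` of
`{b1, b2, b3}` (here `b1 = 6`, `b2 = 7`, `b3 = 8`). -/
theorem stmt_2 :
    Fintype.card (Fin 9) = 9 ∧
    ∀ V : Set (Fin 9), V ⊆ {6, 7, 8} → domNum (graphB.induce Vᶜ) = 3 := by
  refine ⟨by simp, fun V hV => ?_⟩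
  have h0 : (0 : Fin 9) ∈ Vᶜ := fun h => by simpa using hV h
  have h1 : (1 : Fin 9) ∈ Vᶜ := fun h => by simpa using hV h
  have h3 : (3 : Fin 9) ∈ Vᶜ := fun h => by simpa using hV h
  have hmem : 3 ∈ {n : ℕ | ∃ D : Set ↥(Vᶜ), IsDomSet (graphB.induce Vᶜ) D ∧ D.ncard = n} := by
    refine ⟨{⟨0, h0⟩, ⟨1, h1⟩, ⟨3, h3⟩}, ?_, ?_⟩
    · rintro ⟨v, hv⟩ hn
      simp only [Set.mem_insert_iff, Set.mem_singleton_iff, Subtype.mk.injEq, not_or] at hn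
      rcases graphB_three v with h | h | h | h | h | h
      · exact absurd h hn.1
      · exact absurd h hn.2.1
      · exact absurd h hn.2.2
      · exact ⟨⟨0, h0⟩, by simp, h⟩
      · exact ⟨⟨1, h1⟩, by simp, h⟩
      · exact ⟨⟨3, h3⟩, by simp, h⟩
    · rw [Set.ncard_eq_three]
      exact ⟨_, _, _, by simp, by simp, by simp, rfl⟩
  apply le_antisymm
  · exact Nat.sInf_le hmem
  · refine le_csInf ⟨3, hmem⟩ ?_
    rintro n ⟨D, hD, rfl⟩
    by_contra hlt
    have hsub : ∃ a b : ↥(Vᶜ), D ⊆ {a, b} := by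
      have hc : D.ncard = 0 ∨ D.ncard = 1 ∨ D.ncard = 2 := by omega
      rcases hc with h | h | h
      · rw [Set.ncard_eq_zero (Set.toFinite D)] at h
        exact ⟨⟨0, h0⟩, ⟨0, h0⟩, by simp [h]⟩
      · obtain ⟨a, rfl⟩ := Set.ncard_eq_one.1 h
        exact ⟨a, a, by simp⟩
      · obtain ⟨a, b, -, rfl⟩ := Set.ncard_eq_two.1 h
        exact ⟨a, b, subset_rfl⟩
    obtain ⟨a, b, hab⟩ := hsub
    obtain ⟨v, hv, hva, hvb, hna, hnb⟩ := graphB_no_pair a b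
    have hvD : (⟨v, fun h => hv (hV h)⟩ : ↥(Vᶜ)) ∉ D := by
      intro h
      rcases hab h with h | h
      · exact hva (congrArg Subtype.val h)
      · exact hvb (congrArg Subtype.val h)
    obtain ⟨u, hu, huv⟩ := hD _ hvD
    rcases hab hu with rfl | h
    · exact hna huv
    · obtain rfl : u = b := h
      exact hnb huv
end

section
/- The graph S has 17 vertices and γ(S) = γ(S − s) = 6; the graph T has 18 vertices and γ(T − V) = 6 for every subset V of {t1, t2}. -/
open SimpleGraph

/-- The rooted graph `T1(H, {h1, h2})`: two disjoint copies `(X, {x1,x2})`, `(Y, {y1,y2})` of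
`(H, {h1,h2})`, one new vertex `z1 = Sum.inr 0`, and the edges `x1z1`, `z1y1`, `x2y2`;
the distinguished vertex is `s = z1`. -/
def SgraphOf {V : Type*} (H : SimpleGraph V) (h1 h2 : V) :
    SimpleGraph ((V ⊕ V) ⊕ Fin 1) :=
  SimpleGraph.fromRel (fun a b =>
    (∃ x y, H.Adj x y ∧ a = Sum.inl (Sum.inl x) ∧ b = Sum.inl (Sum.inl y)) ∨
    (∃ x y, H.Adj x y ∧ a = Sum.inl (Sum.inr x) ∧ b = Sum.inl (Sum.inr y)) ∨
    (a = Sum.inl (Sum.inl h1) ∧ b = Sum.inr 0) ∨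
    (a = Sum.inr 0 ∧ b = Sum.inl (Sum.inr h1)) ∨
    (a = Sum.inl (Sum.inl h2) ∧ b = Sum.inl (Sum.inr h2)))

/-- The rooted graph `T2(H, {h1, h2})`: two disjoint copies `(X, {x1,x2})`, `(Y, {y1,y2})` of
`(H, {h1,h2})`, two new vertices `z1 = Sum.inr 0`, `z2 = Sum.inr 1`, and the edges
`x1z1`, `z1y1`, `x2z2`, `z2y2`; the distinguished vertices are `t1 = z1`, `t2 = z2`. -/
def TgraphOf {V : Type*} (H : SimpleGraph V) (h1 h2 : V) :
    SimpleGraph ((V ⊕ V) ⊕ Fin 2) :=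
  SimpleGraph.fromRel (fun a b =>
    (∃ x y, H.Adj x y ∧ a = Sum.inl (Sum.inl x) ∧ b = Sum.inl (Sum.inl y)) ∨
    (∃ x y, H.Adj x y ∧ a = Sum.inl (Sum.inr x) ∧ b = Sum.inl (Sum.inr y)) ∨
    (a = Sum.inl (Sum.inl h1) ∧ b = Sum.inr 0) ∨
    (a = Sum.inr 0 ∧ b = Sum.inl (Sum.inr h1)) ∨
    (a = Sum.inl (Sum.inl h2) ∧ b = Sum.inr 1) ∨
    (a = Sum.inr 1 ∧ b = Sum.inl (Sum.inr h2)))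

/-- The rooted graph `(S, s)` built from two copies of `(A, {a1, a2})`. -/
def graphS : SimpleGraph ((Fin 8 ⊕ Fin 8) ⊕ Fin 1) := SgraphOf graphA 6 7

/-- The rooted graph `(T, {t1, t2})` built from two copies of `(A, {a1, a2})`. -/
def graphT : SimpleGraph ((Fin 8 ⊕ Fin 8) ⊕ Fin 2) := TgraphOf graphA 6 7

/-- Decidable version of the adjacency relation of `graphA`. -/
def adjA (x y : Fin 8) : Prop :=
  (x, y) ∈ ([(6, 0), (6, 3), (7, 0), (7, 4), (0, 5), (1, 3), (1, 4), (1, 5), (2, 3), (2, 4),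
    (2, 5)] : List (Fin 8 × Fin 8)) ∨
  (y, x) ∈ ([(6, 0), (6, 3), (7, 0), (7, 4), (0, 5), (1, 3), (1, 4), (1, 5), (2, 3), (2, 4),
    (2, 5)] : List (Fin 8 × Fin 8))

instance : DecidableRel adjA := fun x y => by unfold adjA; infer_instance

theorem graphA_adj_s3 (x y : Fin 8) : graphA.Adj x y ↔ adjA x y := by
  simp only [graphA, SimpleGraph.fromEdgeSet_adj, Set.mem_insert_iff, Set.mem_singleton_iff]
  revert x y
  decide +kernel

/-- `v` is dominated in `A` by `E`. -/
def domA (E : Finset (Fin 8)) (v : Fin 8) : Prop := v ∈ E ∨ ∃ u ∈ E, adjA u v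

instance (E : Finset (Fin 8)) (v : Fin 8) : Decidable (domA E v) := by
  unfold domA; infer_instance

theorem low2 : ∀ E : Finset (Fin 8),
    (∀ v, v ≠ 6 → v ≠ 7 → domA E v) → 2 ≤ E.card := by
  decide +kernel

theorem low6 : ∀ E : Finset (Fin 8), (∀ v, v ≠ 6 → domA E v) → 3 ≤ E.card := by
  decide +kernel

theorem low7 : ∀ E : Finset (Fin 8), (∀ v, v ≠ 7 → domA E v) → 3 ≤ E.card := by
  decide +kernel

open Classical in
/-- The part of `D` in the first copy. -/
noncomputable def partX {Z : Type} (D : Finset ((Fin 8 ⊕ Fin 8) ⊕ Z)) : Finset (Fin 8) :=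
  Finset.univ.filter fun i => Sum.inl (Sum.inl i) ∈ D

open Classical in
/-- The part of `D` in the second copy. -/
noncomputable def partY {Z : Type} (D : Finset ((Fin 8 ⊕ Fin 8) ⊕ Z)) : Finset (Fin 8) :=
  Finset.univ.filter fun i => Sum.inl (Sum.inr i) ∈ D

open Classical in
/-- The part of `D` in the set of new vertices. -/
noncomputable def partZ {Z : Type} [Fintype Z] (D : Finset ((Fin 8 ⊕ Fin 8) ⊕ Z)) : Finset Z :=
  Finset.univ.filter fun i => Sum.inr i ∈ D

theorem card_parts {Z : Type} [Fintype Z] (D : Finset ((Fin 8 ⊕ Fin 8) ⊕ Z)) :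
    D.card = (partX D).card + (partY D).card + (partZ D).card := by
  have h : D = ((partX D).disjSum (partY D)).disjSum (partZ D) := by
    ext v
    rcases v with (v | v) | v <;> simp [partX, partY, partZ]
  conv_lhs => rw [h]
  simp [Finset.card_disjSum]

theorem lowS (D : Finset ((Fin 8 ⊕ Fin 8) ⊕ Fin 1))
    (h : ∀ v, Sum.inl v ∉ D → ∃ u ∈ D, graphS.Adj u (Sum.inl v)) : 6 ≤ D.card := by
  have hX : ∀ v, domA (partX D) v ∨ (v = 6 ∧ 0 ∈ partZ D) ∨ (v = 7 ∧ 7 ∈ partY D) := by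
    intro v
    by_cases hv : Sum.inl (Sum.inl v) ∈ D
    · left; left; simpa [partX] using hv
    · obtain ⟨u, hu, ha⟩ := h _ hv
      rcases u with (u | u) | u <;>
        simp [graphS, SgraphOf, graphA_adj_s3] at ha
      · left; right
        refine ⟨u, by simpa [partX] using hu, ?_⟩
        rcases ha.2 with ha | ha
        · exact ha
        · exact ha.symm
      · right; right
        obtain ⟨rfl, rfl⟩ := ha
        simpa [partY] using hu
      · right; left
        have : u = 0 := Subsingleton.elim _ _
        subst this
        simp_all [partZ]
  have hY : ∀ v, domA (partY D) v ∨ (v = 6 ∧ 0 ∈ partZ D) ∨ (v = 7 ∧ 7 ∈ partX D) := by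
    intro v
    by_cases hv : Sum.inl (Sum.inr v) ∈ D
    · left; left; simpa [partY] using hv
    · obtain ⟨u, hu, ha⟩ := h _ hv
      rcases u with (u | u) | u <;>
        simp [graphS, SgraphOf, graphA_adj_s3] at ha
      · right; right
        obtain ⟨rfl, rfl⟩ := ha
        simpa [partX] using hu
      · left; right
        refine ⟨u, by simpa [partY] using hu, ?_⟩
        rcases ha.2 with ha | ha
        · exact ha
        · exact ha.symm
      · right; left
        have : u = 0 := Subsingleton.elim _ _
        subst this
        simp_all [partZ]
  rw [card_parts]
  have x2 := low2 (partX D) fun v h6 h7 => by have := hX v; clear hX hY; grind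
  have y2 := low2 (partY D) fun v h6 h7 => by have := hY v; clear hX hY; grind
  by_cases hz : 0 ∈ partZ D
  · have z1 : 1 ≤ (partZ D).card := Finset.card_pos.2 ⟨_, hz⟩
    by_cases h7 : 7 ∈ partY D
    · have := low6 (partY D) fun v h6 => by
        rcases hY v with h | h | h
        · exact h
        · exact absurd h.1 h6
        · left; rw [h.1]; exact h7
      omega
    · have := low6 (partX D) fun v h6 => by have := hX v; clear hX hY; grind
      omega
  · have x3 := low7 (partX D) fun v h7 => by have := hX v; clear hX hY; grind
    have y3 := low7 (partY D) fun v h7 => by have := hY v; clear hX hY; grind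
    omega

theorem lowT (D : Finset ((Fin 8 ⊕ Fin 8) ⊕ Fin 2))
    (h : ∀ v, Sum.inl v ∉ D → ∃ u ∈ D, graphT.Adj u (Sum.inl v)) : 6 ≤ D.card := by
  have hX : ∀ v, domA (partX D) v ∨ (v = 6 ∧ 0 ∈ partZ D) ∨ (v = 7 ∧ 1 ∈ partZ D) := by
    intro v
    by_cases hv : Sum.inl (Sum.inl v) ∈ D
    · left; left; simpa [partX] using hv
    · obtain ⟨u, hu, ha⟩ := h _ hv
      rcases u with (u | u) | u <;>
        simp [graphT, TgraphOf, graphA_adj_s3] at ha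
      · left; right
        refine ⟨u, by simpa [partX] using hu, ?_⟩
        rcases ha.2 with ha | ha
        · exact ha
        · exact ha.symm
      · right
        rcases ha with ⟨rfl, rfl⟩ | ⟨rfl, rfl⟩ <;> simp_all [partZ]
  have hY : ∀ v, domA (partY D) v ∨ (v = 6 ∧ 0 ∈ partZ D) ∨ (v = 7 ∧ 1 ∈ partZ D) := by
    intro v
    by_cases hv : Sum.inl (Sum.inr v) ∈ D
    · left; left; simpa [partY] using hv
    · obtain ⟨u, hu, ha⟩ := h _ hv
      rcases u with (u | u) | u <;>
        simp [graphT, TgraphOf, graphA_adj_s3] at ha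
      · left; right
        refine ⟨u, by simpa [partY] using hu, ?_⟩
        rcases ha.2 with ha | ha
        · exact ha
        · exact ha.symm
      · right
        rcases ha with ⟨rfl, rfl⟩ | ⟨rfl, rfl⟩ <;> simp_all [partZ]
  rw [card_parts]
  by_cases h0 : 0 ∈ partZ D
  · by_cases h1 : 1 ∈ partZ D
    · have x2 := low2 (partX D) fun v h6 h7 => by have := hX v; clear hX hY; grind
      have y2 := low2 (partY D) fun v h6 h7 => by have := hY v; clear hX hY; grind
      have z2 : 1 < (partZ D).card := Finset.one_lt_card.2 ⟨0, h0, 1, h1, by decide⟩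
      omega
    · have x3 := low6 (partX D) fun v h6 => by have := hX v; clear hX hY; grind
      have y3 := low6 (partY D) fun v h6 => by have := hY v; clear hX hY; grind
      omega
  · have x3 := low7 (partX D) fun v h7 => by have := hX v; clear hX hY; grind
    have y3 := low7 (partY D) fun v h7 => by have := hY v; clear hX hY; grind
    omega

/-- The dominating set used for all upper bounds. -/
def upSet (Z : Type) [DecidableEq Z] : Finset ((Fin 8 ⊕ Fin 8) ⊕ Z) :=
  (({5, 6, 7} : Finset (Fin 8)).disjSum {5, 6, 7}).disjSum ∅

theorem upA : ∀ v : Fin 8, v ∉ ({5, 6, 7} : Finset (Fin 8)) →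
    ∃ u ∈ ({5, 6, 7} : Finset (Fin 8)), u ≠ v ∧ adjA u v := by
  decide +kernel

theorem upS (v) (hv : v ∉ upSet (Fin 1)) : ∃ u ∈ upSet (Fin 1), graphS.Adj u v := by
  rcases v with (v | v) | v
  · obtain ⟨u, hu, hne, ha⟩ := upA v (by simpa [upSet] using hv)
    exact ⟨Sum.inl (Sum.inl u), by simpa [upSet] using hu,
      by simp [graphS, SgraphOf, graphA_adj_s3, hne, ha]⟩
  · obtain ⟨u, hu, hne, ha⟩ := upA v (by simpa [upSet] using hv)
    exact ⟨Sum.inl (Sum.inr u), by simpa [upSet] using hu,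
      by simp [graphS, SgraphOf, graphA_adj_s3, hne, ha]⟩
  · exact ⟨Sum.inl (Sum.inl 6), by simp [upSet],
      by simp [graphS, SgraphOf, Subsingleton.elim v 0]⟩

theorem upT (v) (hv : v ∉ upSet (Fin 2)) : ∃ u ∈ upSet (Fin 2), graphT.Adj u v := by
  rcases v with (v | v) | v
  · obtain ⟨u, hu, hne, ha⟩ := upA v (by simpa [upSet] using hv)
    exact ⟨Sum.inl (Sum.inl u), by simpa [upSet] using hu,
      by simp [graphT, TgraphOf, graphA_adj_s3, hne, ha]⟩
  · obtain ⟨u, hu, hne, ha⟩ := upA v (by simpa [upSet] using hv)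
    exact ⟨Sum.inl (Sum.inr u), by simpa [upSet] using hu,
      by simp [graphT, TgraphOf, graphA_adj_s3, hne, ha]⟩
  · fin_cases v
    · exact ⟨Sum.inl (Sum.inl 6), by simp [upSet], by simp [graphT, TgraphOf]⟩
    · exact ⟨Sum.inl (Sum.inl 7), by simp [upSet], by simp [graphT, TgraphOf]⟩

theorem domNum_eq_six {W : Type} (G : SimpleGraph W) (D : Set W) (hD : IsDomSet G D)
    (hc : D.ncard = 6) (hlow : ∀ E : Set W, IsDomSet G E → 6 ≤ E.ncard) : domNum G = 6 := by
  apply le_antisymm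
  · exact Nat.sInf_le ⟨D, hD, hc⟩
  · refine le_csInf ⟨6, D, hD, hc⟩ ?_
    rintro n ⟨E, hE, rfl⟩
    exact hlow E hE

theorem domNum_induce {Z : Type} [Fintype Z] [DecidableEq Z]
    (G : SimpleGraph ((Fin 8 ⊕ Fin 8) ⊕ Z)) (K : Set ((Fin 8 ⊕ Fin 8) ⊕ Z))
    (hK : ∀ v, Sum.inl v ∈ K)
    (hup : ∀ v, v ∉ upSet Z → ∃ u ∈ upSet Z, G.Adj u v)
    (hlow : ∀ D : Finset ((Fin 8 ⊕ Fin 8) ⊕ Z),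
      (∀ v, Sum.inl v ∉ D → ∃ u ∈ D, G.Adj u (Sum.inl v)) → 6 ≤ D.card) :
    domNum (G.induce K) = 6 := by
  classical
  have hUK : ∀ v ∈ upSet Z, v ∈ K := by
    rintro (v | v) hv
    · exact hK v
    · simp [upSet] at hv
  apply domNum_eq_six _ (Subtype.val ⁻¹' (upSet Z : Set ((Fin 8 ⊕ Fin 8) ⊕ Z)))
  · intro v hv
    obtain ⟨u, hu, ha⟩ := hup v.1 (by simpa using hv)
    exact ⟨⟨u, hUK u hu⟩, by simpa using hu, by simpa using ha⟩
  · rw [← Set.ncard_image_of_injective _ Subtype.val_injective, Subtype.image_preimage_coe,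
      Set.inter_eq_right.2 (fun v hv => hUK v (by simpa using hv)), Set.ncard_coe_finset]
    simp [upSet, Finset.card_disjSum]
  · intro E hE
    rw [← Set.ncard_image_of_injective _ Subtype.val_injective,
      Set.ncard_eq_toFinset_card']
    apply hlow
    intro v hv
    have hv' : (⟨Sum.inl v, hK v⟩ : K) ∉ E := fun h => hv (by
      simpa using ⟨hK v, h⟩)
    obtain ⟨u, hu, ha⟩ := hE _ hv'
    exact ⟨u.1, by simpa using hu, by simpa using ha⟩

theorem domNum_full {Z : Type} [Fintype Z] [DecidableEq Z]
    (G : SimpleGraph ((Fin 8 ⊕ Fin 8) ⊕ Z))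
    (hup : ∀ v, v ∉ upSet Z → ∃ u ∈ upSet Z, G.Adj u v)
    (hlow : ∀ D : Finset ((Fin 8 ⊕ Fin 8) ⊕ Z),
      (∀ v, Sum.inl v ∉ D → ∃ u ∈ D, G.Adj u (Sum.inl v)) → 6 ≤ D.card) :
    domNum G = 6 := by
  classical
  apply domNum_eq_six _ (upSet Z : Set ((Fin 8 ⊕ Fin 8) ⊕ Z))
  · intro v hv
    obtain ⟨u, hu, ha⟩ := hup v (by simpa using hv)
    exact ⟨u, by simpa using hu, ha⟩
  · rw [Set.ncard_coe_finset]
    simp [upSet, Finset.card_disjSum]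
  · intro E hE
    rw [Set.ncard_eq_toFinset_card']
    apply hlow
    intro v hv
    obtain ⟨u, hu, ha⟩ := hE (Sum.inl v) (by simpa using hv)
    exact ⟨u, by simpa using hu, ha⟩

/-- `S` has 17 vertices and `γ(S) = γ(S − s) = 6`; `T` has 18 vertices and
`γ(T − V) = 6` for every subset `V` of `{t1, t2}`. -/
theorem stmt_3 :
    Fintype.card ((Fin 8 ⊕ Fin 8) ⊕ Fin 1) = 17 ∧
    domNum graphS = 6 ∧
    domNum (graphS.induce (({Sum.inr 0} : Set ((Fin 8 ⊕ Fin 8) ⊕ Fin 1))ᶜ)) = 6 ∧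
    Fintype.card ((Fin 8 ⊕ Fin 8) ⊕ Fin 2) = 18 ∧
    (∀ V : Set ((Fin 8 ⊕ Fin 8) ⊕ Fin 2), V ⊆ {Sum.inr 0, Sum.inr 1} →
      domNum (graphT.induce Vᶜ) = 6) := by
  refine ⟨by simp, domNum_full _ upS lowS, domNum_induce _ _ (by simp) upS lowS, by simp, ?_⟩
  intro V hV
  refine domNum_induce _ _ (fun v hv => ?_) upT lowT
  have := hV hv
  simp at this
end

section
/- The graph P has 20 vertices and γ(P − V) = 7 for every subset V of {p1, p2}. -/
open SimpleGraph

/-- The rooted graph `F2(H, {h1, h2})`: two disjoint copies of `H`, four new vertices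
`x = 0`, `y = 1`, `z1 = 2`, `z2 = 3`, and the edges
`x1x, xz1, z1y, yy1, x2z2, z2y2, z1z2`; distinguished vertices `x` and `y`. -/
def F2graph {V : Type*} (H : SimpleGraph V) (h1 h2 : V) :
    SimpleGraph ((V ⊕ V) ⊕ Fin 4) :=
  SimpleGraph.fromRel (fun a b =>
    (∃ x y, H.Adj x y ∧ a = Sum.inl (Sum.inl x) ∧ b = Sum.inl (Sum.inl y)) ∨
    (∃ x y, H.Adj x y ∧ a = Sum.inl (Sum.inr x) ∧ b = Sum.inl (Sum.inr y)) ∨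
    (a = Sum.inl (Sum.inl h1) ∧ b = Sum.inr 0) ∨
    (a = Sum.inr 0 ∧ b = Sum.inr 2) ∨
    (a = Sum.inr 2 ∧ b = Sum.inr 1) ∨
    (a = Sum.inr 1 ∧ b = Sum.inl (Sum.inr h1)) ∨
    (a = Sum.inl (Sum.inl h2) ∧ b = Sum.inr 3) ∨
    (a = Sum.inr 3 ∧ b = Sum.inl (Sum.inr h2)) ∨
    (a = Sum.inr 2 ∧ b = Sum.inr 3))

/-- The rooted graph `(P, {p1, p2}) = F2(A, {a1, a2})`, with `p1 = Sum.inr 0`, `p2 = Sum.inr 1`. -/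
def graphP : SimpleGraph ((Fin 8 ⊕ Fin 8) ⊕ Fin 4) := F2graph graphA 6 7


/-- Vertices of `P`. -/
abbrev PV := (Fin 8 ⊕ Fin 8) ⊕ Fin 4

instance decA : DecidableRel graphA.Adj := fun a b =>
  decidable_of_iff ((s(a, b) = s(6, 0) ∨ s(a, b) = s(6, 3) ∨ s(a, b) = s(7, 0) ∨ s(a, b) = s(7, 4) ∨
    s(a, b) = s(0, 5) ∨ s(a, b) = s(1, 3) ∨ s(a, b) = s(1, 4) ∨ s(a, b) = s(1, 5) ∨
    s(a, b) = s(2, 3) ∨ s(a, b) = s(2, 4) ∨ s(a, b) = s(2, 5)) ∧ a ≠ b)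
    (by
      unfold graphA
      rw [SimpleGraph.fromEdgeSet_adj]
      simp only [Set.mem_insert_iff, Set.mem_singleton_iff])

/-- Neighbours inside a copy of `A`. -/
def nbA : Fin 8 → List (Fin 8)
  | 0 => [5, 6, 7]
  | 1 => [3, 4, 5]
  | 2 => [3, 4, 5]
  | 3 => [1, 2, 6]
  | 4 => [1, 2, 7]
  | 5 => [0, 1, 2]
  | 6 => [0, 3]
  | 7 => [0, 4]

theorem adjA_nb : ∀ u v : Fin 8, graphA.Adj u v ↔ u ∈ nbA v := by decide +kernel

/-- Neighbours in `P`. -/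
def nbP : PV → List PV
  | .inl (.inl i) => (nbA i).map (fun j => .inl (.inl j)) ++
      (if i = 6 then [.inr 0] else []) ++ (if i = 7 then [.inr 3] else [])
  | .inl (.inr i) => (nbA i).map (fun j => .inl (.inr j)) ++
      (if i = 6 then [.inr 1] else []) ++ (if i = 7 then [.inr 3] else [])
  | .inr 0 => [.inl (.inl 6), .inr 2]
  | .inr 1 => [.inl (.inr 6), .inr 2]
  | .inr 2 => [.inr 0, .inr 1, .inr 3]
  | .inr 3 => [.inl (.inl 7), .inl (.inr 7), .inr 2]

set_option synthInstance.maxSize 10000 in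
set_option synthInstance.maxHeartbeats 400000 in
instance decP : DecidableRel graphP.Adj := by
  unfold graphP F2graph
  intro a b
  rw [SimpleGraph.fromRel_adj]
  infer_instance

set_option synthInstance.maxSize 10000 in
set_option synthInstance.maxHeartbeats 400000 in
theorem adjP_nb : ∀ u v : PV, graphP.Adj u v ↔ u ∈ nbP v := by
  have h : ∀ u v : PV, @decide (graphP.Adj u v) (decP u v) =
      (nbP v).any (fun w => decide (w = u)) := by
    decide +kernel
  intro u v
  rw [← @decide_eq_true_iff _ (decP u v), h u v, List.any_eq_true]
  simp only [decide_eq_true_eq, exists_eq_right]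

set_option synthInstance.maxSize 10000 in
set_option synthInstance.maxHeartbeats 400000 in
theorem half_bool : ∀ a0 a1 a2 a3 a4 a5 a6 a7 : Bool,
    (a0 || (a5 || (a6 || a7))) = true → (a1 || (a3 || (a4 || a5))) = true →
    (a2 || (a3 || (a4 || a5))) = true → (a3 || (a1 || (a2 || a6))) = true →
    (a4 || (a1 || (a2 || a7))) = true → (a5 || (a0 || (a1 || a2))) = true →
    3 ≤ a0.toNat + a1.toNat + a2.toNat + a3.toNat + a4.toNat + a5.toNat + a6.toNat + a7.toNat ∨
    (2 ≤ a0.toNat + a1.toNat + a2.toNat + a3.toNat + a4.toNat + a5.toNat + a6.toNat + a7.toNat ∧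
      (a6 || (a0 || a3)) = false ∧ (a7 || (a0 || a4)) = false) := by decide +kernel

theorem lower (b : PV → Bool)
    (h : ∀ v, v ≠ Sum.inr 0 → v ≠ Sum.inr 1 → (b v || (nbP v).any b) = true) :
    7 ≤ ∑ v, (b v).toNat := by
  have hx := half_bool _ _ _ _ _ _ _ _
    (by simpa [nbP, nbA] using h (.inl (.inl 0)) (by simp) (by simp))
    (by simpa [nbP, nbA] using h (.inl (.inl 1)) (by simp) (by simp))
    (by simpa [nbP, nbA] using h (.inl (.inl 2)) (by simp) (by simp))
    (by simpa [nbP, nbA] using h (.inl (.inl 3)) (by simp) (by simp))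
    (by simpa [nbP, nbA] using h (.inl (.inl 4)) (by simp) (by simp))
    (by simpa [nbP, nbA] using h (.inl (.inl 5)) (by simp) (by simp))
  have hy := half_bool _ _ _ _ _ _ _ _
    (by simpa [nbP, nbA] using h (.inl (.inr 0)) (by simp) (by simp))
    (by simpa [nbP, nbA] using h (.inl (.inr 1)) (by simp) (by simp))
    (by simpa [nbP, nbA] using h (.inl (.inr 2)) (by simp) (by simp))
    (by simpa [nbP, nbA] using h (.inl (.inr 3)) (by simp) (by simp))
    (by simpa [nbP, nbA] using h (.inl (.inr 4)) (by simp) (by simp))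
    (by simpa [nbP, nbA] using h (.inl (.inr 5)) (by simp) (by simp))
  have x6 := h (.inl (.inl 6)) (by simp) (by simp)
  have x7 := h (.inl (.inl 7)) (by simp) (by simp)
  have y6 := h (.inl (.inr 6)) (by simp) (by simp)
  have y7 := h (.inl (.inr 7)) (by simp) (by simp)
  have z := h (.inr 2) (by simp) (by simp)
  simp only [Fintype.sum_sum_type, Fin.sum_univ_eight, Fin.sum_univ_four]
  simp [nbP, nbA] at x6 x7 y6 y7 z
  have k : 1 ≤ (b (.inr 0)).toNat + (b (.inr 1)).toNat + (b (.inr 2)).toNat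
      + (b (.inr 3)).toNat := by
    rcases z with z | z | z | z <;> simp [z] <;> omega
  rcases hx with hx | ⟨hx, hx6, hx7⟩ <;> rcases hy with hy | ⟨hy, hy6, hy7⟩
  · omega
  · have e1 : b (.inr 1) = true := by simp_all
    have e2 : b (.inr 3) = true := by simp_all
    simp only [e1, e2, Bool.toNat_true]
    omega
  · have e1 : b (.inr 0) = true := by simp_all
    have e2 : b (.inr 3) = true := by simp_all
    simp only [e1, e2, Bool.toNat_true]
    omega
  · have e0 : b (.inr 0) = true := by simp_all
    have e1 : b (.inr 1) = true := by simp_all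
    have e2 : b (.inr 3) = true := by simp_all
    simp only [e0, e1, e2, Bool.toNat_true]
    omega

/-- A dominating set of size seven. -/
def D7 : Finset PV := {.inl (.inl 0), .inl (.inl 1), .inl (.inl 2),
  .inl (.inr 0), .inl (.inr 1), .inl (.inr 2), .inr 2}

theorem D7_nb : ∀ v : PV, v ∈ D7 ∨ ((nbP v).any fun u => decide (u ∈ D7)) = true := by
  decide +kernel

theorem D7_dom : ∀ v : PV, v ∉ D7 → ∃ u ∈ D7, graphP.Adj u v := by
  intro v hv
  obtain ⟨u, hu, huD⟩ := List.any_eq_true.1 ((D7_nb v).resolve_left hv)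
  exact ⟨u, of_decide_eq_true huD, (adjP_nb u v).2 hu⟩

/-- The graph `P` has 20 vertices and `γ(P − V) = 7` for every subset `V` of
`{p1, p2}` (here `p1 = Sum.inr 0`, `p2 = Sum.inr 1`). -/
theorem stmt_4 :
    Fintype.card ((Fin 8 ⊕ Fin 8) ⊕ Fin 4) = 20 ∧
    ∀ V : Set ((Fin 8 ⊕ Fin 8) ⊕ Fin 4), V ⊆ {Sum.inr 0, Sum.inr 1} →
      domNum (graphP.induce Vᶜ) = 7 := by
  refine ⟨by simp, fun V hV => ?_⟩
  have hD7 : ∀ u ∈ D7, u ∈ Vᶜ := by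
    intro u hu huV
    rcases hV huV with rfl | h
    · revert hu; decide
    · rw [Set.mem_singleton_iff] at h
      subst h
      revert hu; decide
  unfold domNum
  apply le_antisymm
  · apply Nat.sInf_le
    refine ⟨Subtype.val ⁻¹' (D7 : Set PV), ?_, ?_⟩
    · rintro ⟨v, hv⟩ hvD
      obtain ⟨u, hu, huv⟩ := D7_dom v (by simpa using hvD)
      exact ⟨⟨u, hD7 u hu⟩, by simpa using hu, huv⟩
    · rw [Set.ncard_preimage_of_injective_subset_range Subtype.val_injective]
      · rw [Set.ncard_coe_finset]; decide
      · intro u hu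
        exact ⟨⟨u, hD7 u hu⟩, rfl⟩
  · apply le_csInf
    · exact ⟨_, Set.univ, fun v hv => absurd (Set.mem_univ v) hv, rfl⟩
    · rintro n ⟨D, hD, rfl⟩
      classical
      rw [← Set.ncard_image_of_injective D Subtype.val_injective]
      have key := lower (fun v => decide (v ∈ Subtype.val '' D)) (by
        intro v h0 h1
        have hv : v ∈ Vᶜ := by
          intro hvV
          rcases hV hvV with h | h
          · exact h0 h
          · exact h1 h
        by_cases hvD : (⟨v, hv⟩ : (Vᶜ : Set PV)) ∈ D
        · simp only [Bool.or_eq_true, decide_eq_true_eq]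
          exact Or.inl ⟨_, hvD, rfl⟩
        · obtain ⟨u, hu, huv⟩ := hD _ hvD
          simp only [Bool.or_eq_true, List.any_eq_true, decide_eq_true_eq]
          exact Or.inr ⟨u.1, (adjP_nb _ _).1 huv, ⟨u, hu, rfl⟩⟩)
      refine key.trans (le_of_eq ?_)
      rw [Set.ncard_eq_toFinset_card', ← Set.filter_mem_univ_eq_toFinset, Finset.card_filter]
      refine Finset.sum_congr rfl fun v _ => ?_
      by_cases hv : v ∈ Subtype.val '' D <;> simp only [hv, decide_true, decide_false, if_true, if_false, Bool.toNat_true, Bool.toNat_false]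
end

section
/- The graph Q has 21 vertices and γ(Q − V) = 7 for every subset V of {q1, q2, q3}. -/
open SimpleGraph

/-- The rooted graph `F3(H, {h1, h2})`: two disjoint copies of `H`, five new vertices
`x = 0`, `y = 1`, `z1 = 2`, `z2 = 3`, `z = 4`, and the edges
`x1x, xz1, z1y, yy1, x2z2, z2y2, z1z, zz2`; distinguished vertices `q1 = x`, `q2 = y`, `q3 = z`. -/
def F3graph {V : Type*} (H : SimpleGraph V) (h1 h2 : V) :
    SimpleGraph ((V ⊕ V) ⊕ Fin 5) :=
  SimpleGraph.fromRel (fun a b =>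
    (∃ x y, H.Adj x y ∧ a = Sum.inl (Sum.inl x) ∧ b = Sum.inl (Sum.inl y)) ∨
    (∃ x y, H.Adj x y ∧ a = Sum.inl (Sum.inr x) ∧ b = Sum.inl (Sum.inr y)) ∨
    (a = Sum.inl (Sum.inl h1) ∧ b = Sum.inr 0) ∨
    (a = Sum.inr 0 ∧ b = Sum.inr 2) ∨
    (a = Sum.inr 2 ∧ b = Sum.inr 1) ∨
    (a = Sum.inr 1 ∧ b = Sum.inl (Sum.inr h1)) ∨
    (a = Sum.inl (Sum.inl h2) ∧ b = Sum.inr 3) ∨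
    (a = Sum.inr 3 ∧ b = Sum.inl (Sum.inr h2)) ∨
    (a = Sum.inr 2 ∧ b = Sum.inr 4) ∨
    (a = Sum.inr 4 ∧ b = Sum.inr 3))

/-- The rooted graph `(Q, {q1, q2, q3}) = F3(A, {a1, a2})`, with `q1 = Sum.inr 0`,
`q2 = Sum.inr 1`, `q3 = Sum.inr 4`. -/
def graphQ : SimpleGraph ((Fin 8 ⊕ Fin 8) ⊕ Fin 5) := F3graph graphA 6 7

/-- Lower bound inside one copy of `A`: `p`, `q` say whether `a1`, `a2` are dominated from
outside. -/
lemma copy_bound : ∀ b0 b1 b2 b3 b4 b5 b6 b7 p q : Bool,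
    (b0 || b6 || b7 || b5) = true → (b1 || b3 || b4 || b5) = true →
    (b2 || b3 || b4 || b5) = true → (b3 || b6 || b1 || b2) = true →
    (b4 || b7 || b1 || b2) = true → (b5 || b0 || b1 || b2) = true →
    (b6 || b0 || b3 || p) = true → (b7 || b0 || b4 || q) = true →
    3 ≤ b0.toNat + b1.toNat + b2.toNat + b3.toNat + b4.toNat + b5.toNat + b6.toNat + b7.toNat
      + (p && q).toNat := by
  decide +kernel

lemma adj_iff (E : Set ((Fin 8 ⊕ Fin 8) ⊕ Fin 5)) (v : (Fin 8 ⊕ Fin 8) ⊕ Fin 5) :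
    (∃ u ∈ E, graphQ.Adj u v) ↔
      (∃ i, Sum.inl (Sum.inl i) ∈ E ∧ graphQ.Adj (Sum.inl (Sum.inl i)) v) ∨
      (∃ i, Sum.inl (Sum.inr i) ∈ E ∧ graphQ.Adj (Sum.inl (Sum.inr i)) v) ∨
      (∃ i, Sum.inr i ∈ E ∧ graphQ.Adj (Sum.inr i) v) := by
  simp [Sum.exists, or_assoc]

set_option maxHeartbeats 2000000 in
/-- Lower bound for a set dominating everything but the three roots. -/
lemma lower_s5 (E : Set ((Fin 8 ⊕ Fin 8) ⊕ Fin 5))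
    (h : ∀ v, v ≠ Sum.inr 0 → v ≠ Sum.inr 1 → v ≠ Sum.inr 4 →
      v ∈ E ∨ ∃ u ∈ E, graphQ.Adj u v) : 7 ≤ E.ncard := by
  classical
  let b : (Fin 8 ⊕ Fin 8) ⊕ Fin 5 → Bool := fun v => decide (v ∈ E)
  have hb : ∀ v, v ∈ E ↔ b v = true := fun v => by simp [b]
  have hcard : E.ncard = ∑ v, (b v).toNat := by
    rw [Set.ncard_eq_toFinset_card', Finset.card_eq_sum_ones]
    have : E.toFinset = Finset.univ.filter (fun v => v ∈ E) := by ext; simp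
    rw [this, Finset.sum_filter]
    apply Finset.sum_congr rfl
    intro v _
    by_cases hv : v ∈ E <;> simp [b, hv]
  rw [hcard]
  simp only [Fintype.sum_sum_type, Fin.sum_univ_eight, Fin.sum_univ_five]
  clear hcard
  have key : ∀ v, v ≠ Sum.inr 0 → v ≠ Sum.inr 1 → v ≠ Sum.inr 4 →
      b v = true ∨ (∃ i, b (Sum.inl (Sum.inl i)) = true ∧ graphQ.Adj (Sum.inl (Sum.inl i)) v) ∨
      (∃ i, b (Sum.inl (Sum.inr i)) = true ∧ graphQ.Adj (Sum.inl (Sum.inr i)) v) ∨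
      (∃ i, b (Sum.inr i) = true ∧ graphQ.Adj (Sum.inr i) v) := by
    intro v h0 h1 h4
    have := h v h0 h1 h4
    rw [adj_iff] at this
    simpa only [hb] using this
  clear_value b
  have hX := fun i => key (Sum.inl (Sum.inl i)) (by simp) (by simp) (by simp)
  have hY := fun i => key (Sum.inl (Sum.inr i)) (by simp) (by simp) (by simp)
  have hz := key (Sum.inr 2) (by simp) (by simp) (by simp)
  simp [graphQ, F3graph, graphA, Fin.exists_fin_succ, Fin.forall_fin_succ] at hX hY hz
  have cX := copy_bound (b (.inl (.inl 0))) (b (.inl (.inl 1))) (b (.inl (.inl 2)))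
    (b (.inl (.inl 3))) (b (.inl (.inl 4))) (b (.inl (.inl 5))) (b (.inl (.inl 6)))
    (b (.inl (.inl 7))) (b (.inr 0)) (b (.inr 3))
  have cY := copy_bound (b (.inl (.inr 0))) (b (.inl (.inr 1))) (b (.inl (.inr 2)))
    (b (.inl (.inr 3))) (b (.inl (.inr 4))) (b (.inl (.inr 5))) (b (.inl (.inr 6)))
    (b (.inl (.inr 7))) (b (.inr 1)) (b (.inr 3))
  have eX := cX (by grind) (by grind) (by grind) (by grind) (by grind) (by grind) (by grind)
    (by grind)
  have eY := cY (by grind) (by grind) (by grind) (by grind) (by grind) (by grind) (by grind)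
    (by grind)
  clear cX cY hX hY key h hb
  generalize b (.inr 0) = p at *
  generalize b (.inr 1) = q at *
  generalize b (.inr 2) = r at *
  generalize b (.inr 3) = s at *
  generalize b (.inr 4) = t at *
  cases p <;> cases q <;> cases r <;> cases s <;> cases t <;> simp at hz eX eY ⊢ <;> omega

def goodSet : Finset ((Fin 8 ⊕ Fin 8) ⊕ Fin 5) :=
  {.inl (.inl 0), .inl (.inl 1), .inl (.inl 2), .inl (.inr 0), .inl (.inr 3), .inl (.inr 7), .inr 2}

lemma good_dom : ∀ v, v ∈ goodSet ∨ ∃ u ∈ goodSet, graphQ.Adj u v := by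
  rintro ((v | v) | v) <;> fin_cases v <;> simp [goodSet, graphQ, F3graph, graphA]

/-- The graph `Q` has 21 vertices and `γ(Q − V) = 7` for every subset `V` of
`{q1, q2, q3}`. -/
theorem stmt_5 :
    Fintype.card ((Fin 8 ⊕ Fin 8) ⊕ Fin 5) = 21 ∧
    ∀ V : Set ((Fin 8 ⊕ Fin 8) ⊕ Fin 5), V ⊆ {Sum.inr 0, Sum.inr 1, Sum.inr 4} →
      domNum (graphQ.induce Vᶜ) = 7 := by
  refine ⟨by simp, fun V hV => le_antisymm (Nat.sInf_le ?_) (le_csInf ?_ ?_)⟩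
  · have hsub : ∀ v ∈ goodSet, v ∉ V := by
      intro v hv hvV
      have := hV hvV
      rcases this with rfl | rfl | rfl <;> simp [goodSet] at hv
    refine ⟨{v | v.1 ∈ goodSet}, ?_, ?_⟩
    · intro v hv
      obtain h | ⟨u, hu, huv⟩ := good_dom v.1
      · exact absurd h hv
      · exact ⟨⟨u, hsub u hu⟩, hu, huv⟩
    · rw [← Set.ncard_image_of_injective _ Subtype.val_injective]
      have : Subtype.val '' {v : ↥Vᶜ | v.1 ∈ goodSet} = (goodSet : Set _) := by
        ext v
        simp only [Set.mem_image, Set.mem_ofPred_eq, Finset.mem_coe]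
        exact ⟨fun ⟨w, hw, e⟩ => e ▸ hw, fun h => ⟨⟨v, hsub v h⟩, h, rfl⟩⟩
      rw [this, Set.ncard_coe_finset]
      decide
  · exact ⟨_, Set.univ, fun v hv => absurd (Set.mem_univ v) hv, rfl⟩
  · rintro n ⟨D, hD, rfl⟩
    rw [← Set.ncard_image_of_injective _ Subtype.val_injective]
    apply lower_s5
    intro v h0 h1 h4
    have hv : v ∉ V := fun hvV => by
      rcases hV hvV with h | h | h
      exacts [h0 h, h1 h, h4 h]
    by_cases hvD : (⟨v, hv⟩ : ↥Vᶜ) ∈ D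
    · exact Or.inl ⟨_, hvD, rfl⟩
    · obtain ⟨u, hu, huv⟩ := hD _ hvD
      exact Or.inr ⟨u.1, ⟨u, hu, rfl⟩, huv⟩
end

section
/- Let G be a finite connected simple graph with at least one edge and with no isolated vertices. Then the graph G(P) has v(G) + 20·e(G) vertices and γ(G(P)) = 7·e(G), where v(G) and e(G) denote the number of vertices and edges of G. -/
open SimpleGraph

/-- The 20-vertex type of `P`; `p1 = Sum.inr 0`, `p2 = Sum.inr 1`. -/
abbrev VP : Type := (Fin 8 ⊕ Fin 8) ⊕ Fin 4

/-- The graph `G(P)`, obtained from `G` by replacing every edge by a disjoint copy of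
`(P', {p1', p2'})`.  The endpoints of each edge `e` are given by `fst e` and `snd e`; after the
replacement `p1'` is identified with `fst e` and `p2'` with `snd e`, so the original vertices
of `G` survive, each edge `e` carries a fresh copy of `P`, and `fst e` is joined to `p1` and
`snd e` to `p2` of that copy. -/
def GPgraph {V : Type*} (G : SimpleGraph V) (fst snd : G.edgeSet → V) :
    SimpleGraph (V ⊕ (G.edgeSet × VP)) :=
  SimpleGraph.fromRel (fun a b =>
    (∃ (e : G.edgeSet) (x y : VP), graphP.Adj x y ∧
      a = Sum.inr (e, x) ∧ b = Sum.inr (e, y)) ∨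
    (∃ e : G.edgeSet, a = Sum.inl (fst e) ∧ b = Sum.inr (e, Sum.inr 0)) ∨
    (∃ e : G.edgeSet, a = Sum.inl (snd e) ∧ b = Sum.inr (e, Sum.inr 1)))

instance decAdjA : DecidableRel graphA.Adj := fun a b =>
  decidable_of_iff (s(a, b) ∈ ([s(6, 0), s(6, 3), s(7, 0), s(7, 4), s(0, 5),
     s(1, 3), s(1, 4), s(1, 5), s(2, 3), s(2, 4), s(2, 5)] : List (Sym2 (Fin 8))) ∧ a ≠ b)
    (by simp [graphA])

/-- Domination inside one copy of `A`: the six vertices of `K₃₃` need at least two vertices, and if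
one of `a1`, `a2` is dominated from within as well, then at least three. -/
lemma domA_s8 (S : Finset (Fin 8))
    (h : ∀ v : Fin 8, v ≠ 6 → v ≠ 7 → v ∈ S ∨ ∃ u ∈ S, graphA.Adj u v) :
    2 ≤ S.card ∧ ((∃ w, (w = 6 ∨ w = 7) ∧ (w ∈ S ∨ ∃ u ∈ S, graphA.Adj u w)) → 3 ≤ S.card) := by
  revert h
  revert S
  decide +kernel

lemma adjX (u : VP) (v : Fin 8) (h : graphP.Adj u (Sum.inl (Sum.inl v))) :
    (∃ u', graphA.Adj u' v ∧ u = Sum.inl (Sum.inl u')) ∨ (v = 6 ∧ u = Sum.inr 0) ∨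
      (v = 7 ∧ u = Sum.inr 3) := by
  unfold graphP F2graph at h
  rw [SimpleGraph.fromRel_adj] at h
  obtain ⟨-, h | h⟩ := h
  · simp at h
    grind
  · simp at h
    grind [SimpleGraph.Adj.symm]

lemma adjY (u : VP) (v : Fin 8) (h : graphP.Adj u (Sum.inl (Sum.inr v))) :
    (∃ u', graphA.Adj u' v ∧ u = Sum.inl (Sum.inr u')) ∨ (v = 6 ∧ u = Sum.inr 1) ∨
      (v = 7 ∧ u = Sum.inr 3) := by
  unfold graphP F2graph at h
  rw [SimpleGraph.fromRel_adj] at h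
  obtain ⟨-, h | h⟩ := h
  · simp at h
    grind
  · simp at h
    grind [SimpleGraph.Adj.symm]

lemma adjZ (u : VP) (h : graphP.Adj u (Sum.inr 2)) : ∃ i, u = Sum.inr i := by
  unfold graphP F2graph at h
  rw [SimpleGraph.fromRel_adj] at h
  obtain ⟨-, h | h⟩ := h
  · simp at h
    grind
  · simp at h
    grind [SimpleGraph.Adj.symm]

/-- A set dominating all of `P` except possibly `p1` and `p2` has at least seven vertices. -/
lemma domP (S : Finset VP)
    (h : ∀ v : VP, v ≠ Sum.inr 0 → v ≠ Sum.inr 1 → v ∈ S ∨ ∃ u ∈ S, graphP.Adj u v) :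
    7 ≤ S.card := by
  classical
  set X : Finset (Fin 8) := Finset.univ.filter (fun v => Sum.inl (Sum.inl v) ∈ S) with hX
  set Y : Finset (Fin 8) := Finset.univ.filter (fun v => Sum.inl (Sum.inr v) ∈ S) with hY
  set Z : Finset (Fin 4) := Finset.univ.filter (fun v => Sum.inr v ∈ S) with hZ
  have hcard : S.card = X.card + Y.card + Z.card := by
    have h1 : S = Finset.univ.filter (fun v => v ∈ S) := by simp
    rw [h1, Finset.card_filter, Fintype.sum_sum_type, Fintype.sum_sum_type, hX, hY, hZ,
      Finset.card_filter, Finset.card_filter, Finset.card_filter]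
  have kX : ∀ v : Fin 8, (v ∈ X ∨ ∃ u ∈ X, graphA.Adj u v) ∨ (v = 6 ∧ 0 ∈ Z) ∨
      (v = 7 ∧ 3 ∈ Z) := by
    intro v
    rcases h (Sum.inl (Sum.inl v)) (by simp) (by simp) with h1 | ⟨u, hu, ha⟩
    · left; left; simpa [hX] using h1
    · rcases adjX u v ha with ⟨u', hu', rfl⟩ | ⟨hv, rfl⟩ | ⟨hv, rfl⟩
      · left; right; exact ⟨u', by simpa [hX] using hu, hu'⟩
      · right; left; exact ⟨hv, by simpa [hZ] using hu⟩
      · right; right; exact ⟨hv, by simpa [hZ] using hu⟩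
  have kY : ∀ v : Fin 8, (v ∈ Y ∨ ∃ u ∈ Y, graphA.Adj u v) ∨ (v = 6 ∧ 1 ∈ Z) ∨
      (v = 7 ∧ 3 ∈ Z) := by
    intro v
    rcases h (Sum.inl (Sum.inr v)) (by simp) (by simp) with h1 | ⟨u, hu, ha⟩
    · left; left; simpa [hY] using h1
    · rcases adjY u v ha with ⟨u', hu', rfl⟩ | ⟨hv, rfl⟩ | ⟨hv, rfl⟩
      · left; right; exact ⟨u', by simpa [hY] using hu, hu'⟩
      · right; left; exact ⟨hv, by simpa [hZ] using hu⟩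
      · right; right; exact ⟨hv, by simpa [hZ] using hu⟩
  have kZ : Z.Nonempty := by
    rcases h (Sum.inr 2) (by simp) (by simp) with h1 | ⟨u, hu, ha⟩
    · exact ⟨2, by simpa [hZ] using h1⟩
    · obtain ⟨i, rfl⟩ := adjZ u ha
      exact ⟨i, by simpa [hZ] using hu⟩
  have dX := domA_s8 X (fun v h6 h7 => by
    rcases kX v with h1 | h1 | h1
    · exact h1
    · exact absurd h1.1 h6
    · exact absurd h1.1 h7)
  have dY := domA_s8 Y (fun v h6 h7 => by
    rcases kY v with h1 | h1 | h1
    · exact h1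
    · exact absurd h1.1 h6
    · exact absurd h1.1 h7)
  have eX : 3 ≤ X.card ∨ (0 ∈ Z ∧ 3 ∈ Z) := by
    by_cases h3 : 3 ≤ X.card
    · exact Or.inl h3
    · right
      constructor
      · rcases kX 6 with h1 | h1 | h1
        · exact absurd (dX.2 ⟨6, by simp, h1⟩) h3
        · exact h1.2
        · exact absurd h1.1 (by decide)
      · rcases kX 7 with h1 | h1 | h1
        · exact absurd (dX.2 ⟨7, by simp, h1⟩) h3
        · exact absurd h1.1 (by decide)
        · exact h1.2
  have eY : 3 ≤ Y.card ∨ (1 ∈ Z ∧ 3 ∈ Z) := by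
    by_cases h3 : 3 ≤ Y.card
    · exact Or.inl h3
    · right
      constructor
      · rcases kY 6 with h1 | h1 | h1
        · exact absurd (dY.2 ⟨6, by simp, h1⟩) h3
        · exact h1.2
        · exact absurd h1.1 (by decide)
      · rcases kY 7 with h1 | h1 | h1
        · exact absurd (dY.2 ⟨7, by simp, h1⟩) h3
        · exact absurd h1.1 (by decide)
        · exact h1.2
  have cZ : 1 ≤ Z.card := kZ.card_pos
  have c03 : 0 ∈ Z ∧ 3 ∈ Z → 2 ≤ Z.card := by clear_value Z; clear * -; revert Z; decide +kernel
  have c13 : 1 ∈ Z ∧ 3 ∈ Z → 2 ≤ Z.card := by clear_value Z; clear * -; revert Z; decide +kernel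
  have c013 : 0 ∈ Z ∧ 3 ∈ Z → 1 ∈ Z ∧ 3 ∈ Z → 3 ≤ Z.card := by
    clear_value Z; clear * -; revert Z; decide +kernel
  have := dX.1
  have := dY.1
  rcases eX with a | a <;> rcases eY with b | b
  · omega
  · have := c13 b; omega
  · have := c03 a; omega
  · have := c013 a b; omega

/-- A dominating set of `P` with seven vertices containing `p1` and `p2`. -/
def domSetP : Finset VP :=
  {Sum.inl (Sum.inl 2), Sum.inl (Sum.inl 5), Sum.inl (Sum.inr 2), Sum.inl (Sum.inr 5),
    Sum.inr 0, Sum.inr 1, Sum.inr 3}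

lemma domSetP_card : domSetP.card = 7 := by decide +kernel

lemma graphP_adj_X (a b : Fin 8) (h : graphA.Adj a b) :
    graphP.Adj (Sum.inl (Sum.inl a)) (Sum.inl (Sum.inl b)) := by
  unfold graphP F2graph
  rw [SimpleGraph.fromRel_adj]
  exact ⟨by simpa using h.ne, Or.inl (Or.inl ⟨a, b, h, rfl, rfl⟩)⟩

lemma graphP_adj_Y (a b : Fin 8) (h : graphA.Adj a b) :
    graphP.Adj (Sum.inl (Sum.inr a)) (Sum.inl (Sum.inr b)) := by
  unfold graphP F2graph
  rw [SimpleGraph.fromRel_adj]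
  exact ⟨by simpa using h.ne, Or.inl (Or.inr (Or.inl ⟨a, b, h, rfl, rfl⟩))⟩

lemma dom25 : ∀ v : Fin 8, v = 6 ∨ v = 7 ∨ v = 2 ∨ v = 5 ∨ graphA.Adj 2 v ∨ graphA.Adj 5 v := by
  decide

lemma domSetP_dom : ∀ v : VP, v ∉ domSetP → ∃ u ∈ domSetP, graphP.Adj u v := by
  rintro ((v | v) | v) hv
  · rcases dom25 v with rfl | rfl | rfl | rfl | h | h
    · exact ⟨Sum.inr 0, by simp [domSetP], by simp [graphP, F2graph]⟩
    · exact ⟨Sum.inr 3, by simp [domSetP], by simp [graphP, F2graph]⟩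
    · exact absurd (by simp [domSetP]) hv
    · exact absurd (by simp [domSetP]) hv
    · exact ⟨_, by simp [domSetP], graphP_adj_X _ _ h⟩
    · exact ⟨_, by simp [domSetP], graphP_adj_X _ _ h⟩
  · rcases dom25 v with rfl | rfl | rfl | rfl | h | h
    · exact ⟨Sum.inr 1, by simp [domSetP], by simp [graphP, F2graph]⟩
    · exact ⟨Sum.inr 3, by simp [domSetP], by simp [graphP, F2graph]⟩
    · exact absurd (by simp [domSetP]) hv
    · exact absurd (by simp [domSetP]) hv
    · exact ⟨_, by simp [domSetP], graphP_adj_Y _ _ h⟩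
    · exact ⟨_, by simp [domSetP], graphP_adj_Y _ _ h⟩
  · refine ⟨Sum.inr 0, by simp [domSetP], ?_⟩
    have hv2 : v = 2 := by
      fin_cases v <;> simp [domSetP] at hv ⊢
    subst hv2
    simp [graphP, F2graph]

lemma GP_adj_inr {V : Type*} (G : SimpleGraph V) (fst snd : G.edgeSet → V) (e : G.edgeSet)
    (a b : VP) (h : graphP.Adj a b) :
    (GPgraph G fst snd).Adj (Sum.inr (e, a)) (Sum.inr (e, b)) := by
  rw [GPgraph, SimpleGraph.fromRel_adj]
  refine ⟨?_, Or.inl (Or.inl ⟨e, a, b, h, rfl, rfl⟩)⟩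
  intro hh
  simp only [Sum.inr.injEq, Prod.mk.injEq, true_and] at hh
  exact h.ne hh

lemma GP_adj_to {V : Type*} (G : SimpleGraph V) (fst snd : G.edgeSet → V) (e : G.edgeSet)
    (b : VP) (h0 : b ≠ Sum.inr 0) (h1 : b ≠ Sum.inr 1) (u : V ⊕ (G.edgeSet × VP))
    (h : (GPgraph G fst snd).Adj u (Sum.inr (e, b))) :
    ∃ a, u = Sum.inr (e, a) ∧ graphP.Adj a b := by
  rw [GPgraph, SimpleGraph.fromRel_adj] at h
  obtain ⟨-, (⟨e', x, y, hxy, rfl, hb⟩ | ⟨e', -, hb⟩ | ⟨e', -, hb⟩) |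
    (⟨e', x, y, hxy, hb, rfl⟩ | ⟨e', hb, -⟩ | ⟨e', hb, -⟩)⟩ := h
  · simp only [Sum.inr.injEq, Prod.mk.injEq] at hb
    obtain ⟨rfl, rfl⟩ := hb
    exact ⟨x, rfl, hxy⟩
  · simp only [Sum.inr.injEq, Prod.mk.injEq] at hb
    exact absurd hb.2 h0
  · simp only [Sum.inr.injEq, Prod.mk.injEq] at hb
    exact absurd hb.2 h1
  · simp only [Sum.inr.injEq, Prod.mk.injEq] at hb
    obtain ⟨rfl, rfl⟩ := hb
    exact ⟨y, rfl, hxy.symm⟩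
  · exact absurd hb (by simp)
  · exact absurd hb (by simp)

/-- Let `G` be a finite connected simple graph with at least one edge and no
isolated vertices.  Then `G(P)` has `v(G) + 20·e(G)` vertices and `γ(G(P)) = 7·e(G)`. -/
theorem stmt_8 {V : Type*} [Fintype V] (G : SimpleGraph V)
    (hconn : G.Connected) (hE : G.edgeSet.Nonempty)
    (hiso : ∀ v : V, ∃ u : V, G.Adj v u)
    (fst snd : G.edgeSet → V)
    (hends : ∀ e : G.edgeSet, s(fst e, snd e) = (e : Sym2 V)) :
    Nat.card (V ⊕ (G.edgeSet × VP)) = Fintype.card V + 20 * G.edgeSet.ncard ∧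
    domNum (GPgraph G fst snd) = 7 * G.edgeSet.ncard := by
  classical
  have hfin : Fintype G.edgeSet := Fintype.ofFinite _
  have hcE : Fintype.card G.edgeSet = G.edgeSet.ncard := by
    rw [← Nat.card_eq_fintype_card, Nat.card_coe_set_eq]
  refine ⟨?_, ?_⟩
  · rw [Nat.card_eq_fintype_card, Fintype.card_sum, Fintype.card_prod, hcE]
    simp [VP]
    ring
  · apply le_antisymm
    · apply Nat.sInf_le
      refine ⟨((Finset.univ ×ˢ domSetP).map Function.Embedding.inr :
        Finset (V ⊕ (G.edgeSet × VP))), ?_, ?_⟩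
      · have hmem : ∀ (e : G.edgeSet) (a : VP), a ∈ domSetP →
            (Sum.inr (e, a) : V ⊕ (G.edgeSet × VP)) ∈
            (((Finset.univ ×ˢ domSetP).map Function.Embedding.inr :
              Finset (V ⊕ (G.edgeSet × VP))) : Set (V ⊕ (G.edgeSet × VP))) := by
          intro e a ha
          simpa using ha
        rintro (v | ⟨e, b⟩) hv
        · obtain ⟨u, hu⟩ := hiso v
          have he := hends ⟨s(v, u), hu⟩
          have hv' : v ∈ s(fst ⟨s(v, u), hu⟩, snd ⟨s(v, u), hu⟩) := by
            rw [he]; simp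
          rcases Sym2.mem_iff.1 hv' with h1 | h1
          · refine ⟨Sum.inr (⟨s(v, u), hu⟩, Sum.inr 0), hmem _ _ (by decide), ?_⟩
            rw [GPgraph, SimpleGraph.fromRel_adj]
            exact ⟨by simp, Or.inr (Or.inr (Or.inl ⟨⟨s(v, u), hu⟩, by rw [← h1], rfl⟩))⟩
          · refine ⟨Sum.inr (⟨s(v, u), hu⟩, Sum.inr 1), hmem _ _ (by decide), ?_⟩
            rw [GPgraph, SimpleGraph.fromRel_adj]
            exact ⟨by simp, Or.inr (Or.inr (Or.inr ⟨⟨s(v, u), hu⟩, by rw [← h1], rfl⟩))⟩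
        · have hb : b ∉ domSetP := fun hb => hv (hmem e b hb)
          obtain ⟨a, ha, hab⟩ := domSetP_dom b hb
          exact ⟨_, hmem e a ha, GP_adj_inr G fst snd e a b hab⟩
      · rw [Set.ncard_coe_finset, Finset.card_map, Finset.card_product, domSetP_card,
          Finset.card_univ, hcE, mul_comm]
    · apply le_csInf
      · exact ⟨_, Set.univ, fun v hv => absurd (Set.mem_univ v) hv, rfl⟩
      · rintro n ⟨D, hD, rfl⟩
        have key : ∀ e : G.edgeSet,
            7 ≤ (Finset.univ.filter (fun x : VP => Sum.inr (e, x) ∈ D)).card := by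
          intro e
          apply domP
          intro b h0 h1
          by_cases hb : Sum.inr (e, b) ∈ D
          · left; simpa using hb
          · right
            obtain ⟨u, hu, hadj⟩ := hD _ hb
            obtain ⟨a, rfl, hab⟩ := GP_adj_to G fst snd e b h0 h1 u hadj
            exact ⟨a, by simpa using hu, hab⟩
        calc 7 * G.edgeSet.ncard = ∑ _e : G.edgeSet, 7 := by
              rw [Finset.sum_const, Finset.card_univ, hcE, smul_eq_mul, mul_comm]
          _ ≤ ∑ e : G.edgeSet,
              (Finset.univ.filter (fun x : VP => Sum.inr (e, x) ∈ D)).card :=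
              Finset.sum_le_sum fun e _ => key e
          _ = (Finset.univ.filter (fun p : G.edgeSet × VP => Sum.inr p ∈ D)).card := by
              rw [Finset.card_filter, Fintype.sum_prod_type]
              exact Finset.sum_congr rfl fun e _ => Finset.card_filter _ _
          _ = (((Finset.univ.filter (fun p : G.edgeSet × VP => Sum.inr p ∈ D)).map
                Function.Embedding.inr : Finset (V ⊕ (G.edgeSet × VP))) :
                Set (V ⊕ (G.edgeSet × VP))).ncard := by
              rw [Set.ncard_coe_finset, Finset.card_map]
          _ ≤ D.ncard := by
              apply Set.ncard_le_ncard _ (Set.toFinite D)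
              intro x hx
              simp only [Finset.coe_map, Set.mem_image, Finset.mem_coe, Finset.mem_filter] at hx
              obtain ⟨p, hp, rfl⟩ := hx
              exact hp.2
end

section
/- Define rooted graphs (P^i, {p1^i, p2^i}) recursively by P^1 = (P, {p1,p2}) and P^{i+1} = F2(P^i, {p1^i, p2^i}). For every i ≥ 1: (a) γ(P^{i+1}) = 2·γ(P^i) + 1 and γ(P^i − V) = γ(P^i) for every subset V of {p1^i, p2^i}; and (b) P^i has 3·2^{i+2} − 4 vertices and γ(P^i) = 2^{i+2} − 1. -/
open SimpleGraph

/-- The vertex type of the rooted graph `P^i` (`i ≥ 1`; the value at `0` is a dummy equal to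
the value at `1`): `P^1 = P` and `P^{i+1} = F2(P^i)`. -/
def VPt : ℕ → Type
  | 0 => (Fin 8 ⊕ Fin 8) ⊕ Fin 4
  | 1 => (Fin 8 ⊕ Fin 8) ⊕ Fin 4
  | (i + 2) => (VPt (i + 1) ⊕ VPt (i + 1)) ⊕ Fin 4

/-- The first root `p1^i` of `P^i`. -/
def proot1 : (i : ℕ) → VPt i
  | 0 => Sum.inr 0
  | 1 => Sum.inr 0
  | (_ + 2) => Sum.inr 0

/-- The second root `p2^i` of `P^i`. -/
def proot2 : (i : ℕ) → VPt i
  | 0 => Sum.inr 1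
  | 1 => Sum.inr 1
  | (_ + 2) => Sum.inr 1

/-- The rooted graphs `P^i`: `P^1 = (P, {p1, p2})` and
`P^{i+1} = F2(P^i, {p1^i, p2^i})`. -/
def Pgraphs : (i : ℕ) → SimpleGraph (VPt i)
  | 0 => graphP
  | 1 => graphP
  | (i + 2) => F2graph (Pgraphs (i + 1)) (proot1 (i + 1)) (proot2 (i + 1))

/-- Strengthened invariant: weakly dominating sets (the roots need not be dominated) have at least
`g` elements, and some dominating set avoiding the set `R` has exactly `g` elements. -/
def DomInv {V : Type*} (H : SimpleGraph V) (h1 h2 : V) (R : Set V) (g : ℕ) : Prop :=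
  (∀ D : Set V, (∀ v, v ∉ D → v ≠ h1 → v ≠ h2 → ∃ u ∈ D, H.Adj u v) → g ≤ D.ncard) ∧
  ∃ D : Set V, IsDomSet H D ∧ D.ncard = g ∧ Disjoint D R

theorem domNum_eq_of_inv {V : Type*} {H : SimpleGraph V} {h1 h2 : V} {R : Set V} {g : ℕ}
    (h : DomInv H h1 h2 R g) : domNum H = g := by
  obtain ⟨hl, D, hD, hc, -⟩ := h
  have key : ∃ E : Set V, IsDomSet H E ∧ E.ncard = g := ⟨D, hD, hc⟩
  apply le_antisymm
  · exact Nat.sInf_le key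
  · apply le_csInf ⟨g, key⟩
    rintro n ⟨E, hE, rfl⟩
    exact hl E fun v hv _ _ => hE v hv

theorem domNum_induce_of_inv {V : Type*} {H : SimpleGraph V} {h1 h2 : V} {g : ℕ}
    (h : DomInv H h1 h2 {h1, h2} g) (S : Set V) (hS : S ⊆ {h1, h2}) :
    domNum (H.induce Sᶜ) = g := by
  obtain ⟨hl, D, hD, hc, hdis⟩ := h
  have hsub : D ⊆ Sᶜ := fun x hx hxS => Set.disjoint_left.1 hdis hx (hS hxS)
  have key : ∃ E : Set (Sᶜ : Set V), IsDomSet (H.induce Sᶜ) E ∧ E.ncard = g := by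
    refine ⟨Subtype.val ⁻¹' D, ?_, ?_⟩
    · intro v hv
      obtain ⟨u, hu, ha⟩ := hD v.1 hv
      exact ⟨⟨u, hsub hu⟩, hu, ha⟩
    · rw [← Set.ncard_image_of_injective _ Subtype.val_injective, Subtype.image_preimage_coe,
        Set.inter_eq_right.2 hsub, hc]
  apply le_antisymm
  · exact Nat.sInf_le key
  · apply le_csInf ⟨g, key⟩
    rintro n ⟨E, hE, rfl⟩
    rw [← Set.ncard_image_of_injective E Subtype.val_injective]
    apply hl
    intro v hv n1 n2
    have hvS : v ∈ Sᶜ := fun hv' => by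
      rcases hS hv' with h | h
      · exact n1 h
      · exact n2 h
    obtain ⟨u, hu, ha⟩ := hE ⟨v, hvS⟩ (fun hm => hv ⟨_, hm, rfl⟩)
    exact ⟨u.1, ⟨u, hu, rfl⟩, ha⟩

/-- Weaker form of the invariant: excusing one root costs nothing, excusing both roots may save
one element. This is what the graph `A` satisfies. -/
def WeakInv {V : Type*} (H : SimpleGraph V) (h1 h2 : V) (g : ℕ) : Prop :=
  (∀ D : Set V, (∀ v, v ∉ D → v ≠ h1 → v ≠ h2 → ∃ u ∈ D, H.Adj u v) → g ≤ D.ncard + 1) ∧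
  (∀ D : Set V, (∀ v, v ∉ D → v ≠ h1 → ∃ u ∈ D, H.Adj u v) → g ≤ D.ncard) ∧
  (∀ D : Set V, (∀ v, v ∉ D → v ≠ h2 → ∃ u ∈ D, H.Adj u v) → g ≤ D.ncard) ∧
  ∃ D : Set V, IsDomSet H D ∧ D.ncard = g

theorem DomInv.weak {V : Type*} {H : SimpleGraph V} {h1 h2 : V} {R : Set V} {g : ℕ}
    (h : DomInv H h1 h2 R g) : WeakInv H h1 h2 g := by
  obtain ⟨hl, D, hD, hc, -⟩ := h
  exact ⟨fun E hE => (hl E hE).trans (Nat.le_succ _), fun E hE => hl E fun v hv a _ => hE v hv a,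
    fun E hE => hl E fun v hv _ a => hE v hv a, D, hD, hc⟩

theorem F2_inv {V : Type*} [Finite V] {H : SimpleGraph V} {h1 h2 : V} {g : ℕ}
    (h : WeakInv H h1 h2 g) :
    DomInv (F2graph H h1 h2) (Sum.inr 0) (Sum.inr 1) {Sum.inr 0, Sum.inr 1} (2 * g + 1) := by
  obtain ⟨hl, hl1, hl2, D, hD, hc⟩ := h
  have iX : Function.Injective (fun v : V => (Sum.inl (Sum.inl v) : (V ⊕ V) ⊕ Fin 4)) :=
    fun a b hab => by simpa using hab
  have iY : Function.Injective (fun v : V => (Sum.inl (Sum.inr v) : (V ⊕ V) ⊕ Fin 4)) :=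
    fun a b hab => by simpa using hab
  have iZ : Function.Injective (fun v : Fin 4 => (Sum.inr v : (V ⊕ V) ⊕ Fin 4)) :=
    fun a b hab => by simpa using hab
  have card3 : ∀ (X Y : Set V) (Z : Set (Fin 4)),
      ((fun v : V => (Sum.inl (Sum.inl v) : (V ⊕ V) ⊕ Fin 4)) '' X ∪
        (fun v : V => (Sum.inl (Sum.inr v) : (V ⊕ V) ⊕ Fin 4)) '' Y ∪
        (fun v : Fin 4 => (Sum.inr v : (V ⊕ V) ⊕ Fin 4)) '' Z).ncard
      = X.ncard + Y.ncard + Z.ncard := by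
    intro X Y Z
    rw [Set.ncard_union_eq, Set.ncard_union_eq, Set.ncard_image_of_injective _ iX,
      Set.ncard_image_of_injective _ iY, Set.ncard_image_of_injective _ iZ]
    · rw [Set.disjoint_left]; rintro _ ⟨a, _, rfl⟩ ⟨b, _, hb⟩; simp at hb
    · rw [Set.disjoint_left]; rintro _ (⟨a, _, rfl⟩ | ⟨a, _, rfl⟩) ⟨b, _, hb⟩ <;> simp at hb
  constructor
  · intro E hE
    have hX : ∀ v : V, (Sum.inl (Sum.inl v) : (V ⊕ V) ⊕ Fin 4) ∉ E →
        (v = h1 → (Sum.inr 0 : (V ⊕ V) ⊕ Fin 4) ∉ E) →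
        (v = h2 → (Sum.inr 3 : (V ⊕ V) ⊕ Fin 4) ∉ E) →
        ∃ u ∈ {v : V | (Sum.inl (Sum.inl v) : (V ⊕ V) ⊕ Fin 4) ∈ E}, H.Adj u v := by
      intro v hv n1 n2
      obtain ⟨u, hu, ha⟩ := hE (Sum.inl (Sum.inl v)) hv (by simp) (by simp)
      rcases u with (u | u) | u
      · refine ⟨u, hu, ?_⟩
        simp [F2graph] at ha
        rcases ha.2 with h | h
        · exact h
        · exact h.symm
      · simp [F2graph] at ha
      · exfalso
        simp [F2graph] at ha
        rcases ha with ⟨h, rfl⟩ | ⟨h, rfl⟩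
        · exact n1 h hu
        · exact n2 h hu
    have hXl : g ≤ {v : V | (Sum.inl (Sum.inl v) : (V ⊕ V) ⊕ Fin 4) ∈ E}.ncard + 1 :=
      hl _ fun v hv n1 n2 => hX v hv (fun e => absurd e n1) (fun e => absurd e n2)
    have hX1 : (Sum.inr 3 : (V ⊕ V) ⊕ Fin 4) ∉ E → g ≤ {v : V | (Sum.inl (Sum.inl v) : (V ⊕ V) ⊕ Fin 4) ∈ E}.ncard :=
      fun h => hl1 _ fun v hv n1 => hX v hv (fun e => absurd e n1) (fun _ => h)
    have hX2 : (Sum.inr 0 : (V ⊕ V) ⊕ Fin 4) ∉ E → g ≤ {v : V | (Sum.inl (Sum.inl v) : (V ⊕ V) ⊕ Fin 4) ∈ E}.ncard :=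
      fun h => hl2 _ fun v hv n2 => hX v hv (fun _ => h) (fun e => absurd e n2)
    have hY : ∀ v : V, (Sum.inl (Sum.inr v) : (V ⊕ V) ⊕ Fin 4) ∉ E →
        (v = h1 → (Sum.inr 1 : (V ⊕ V) ⊕ Fin 4) ∉ E) →
        (v = h2 → (Sum.inr 3 : (V ⊕ V) ⊕ Fin 4) ∉ E) →
        ∃ u ∈ {v : V | (Sum.inl (Sum.inr v) : (V ⊕ V) ⊕ Fin 4) ∈ E}, H.Adj u v := by
      intro v hv n1 n2
      obtain ⟨u, hu, ha⟩ := hE (Sum.inl (Sum.inr v)) hv (by simp) (by simp)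
      rcases u with (u | u) | u
      · simp [F2graph] at ha
      · refine ⟨u, hu, ?_⟩
        simp [F2graph] at ha
        rcases ha.2 with h | h
        · exact h
        · exact h.symm
      · exfalso
        simp [F2graph] at ha
        rcases ha with ⟨rfl, h⟩ | ⟨rfl, h⟩
        · exact n1 h hu
        · exact n2 h hu
    have hYl : g ≤ {v : V | (Sum.inl (Sum.inr v) : (V ⊕ V) ⊕ Fin 4) ∈ E}.ncard + 1 :=
      hl _ fun v hv n1 n2 => hY v hv (fun e => absurd e n1) (fun e => absurd e n2)
    have hY1 : (Sum.inr 3 : (V ⊕ V) ⊕ Fin 4) ∉ E → g ≤ {v : V | (Sum.inl (Sum.inr v) : (V ⊕ V) ⊕ Fin 4) ∈ E}.ncard :=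
      fun h => hl1 _ fun v hv n1 => hY v hv (fun e => absurd e n1) (fun _ => h)
    have hY2 : (Sum.inr 1 : (V ⊕ V) ⊕ Fin 4) ∉ E → g ≤ {v : V | (Sum.inl (Sum.inr v) : (V ⊕ V) ⊕ Fin 4) ∈ E}.ncard :=
      fun h => hl2 _ fun v hv n2 => hY v hv (fun _ => h) (fun e => absurd e n2)
    have hZl : 0 < {v : Fin 4 | (Sum.inr v : (V ⊕ V) ⊕ Fin 4) ∈ E}.ncard := by
      rw [Set.ncard_pos]
      by_cases h2 : (Sum.inr 2 : (V ⊕ V) ⊕ Fin 4) ∈ E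
      · exact ⟨2, h2⟩
      · obtain ⟨u, hu, ha⟩ := hE (Sum.inr 2) h2 (by simp) (by simp)
        rcases u with (u | u) | u
        · simp [F2graph] at ha
        · simp [F2graph] at ha
        · exact ⟨u, hu⟩
    have hdec : E = (fun v : V => (Sum.inl (Sum.inl v) : (V ⊕ V) ⊕ Fin 4)) ''
          {v : V | (Sum.inl (Sum.inl v) : (V ⊕ V) ⊕ Fin 4) ∈ E} ∪
        (fun v : V => (Sum.inl (Sum.inr v) : (V ⊕ V) ⊕ Fin 4)) ''
          {v : V | (Sum.inl (Sum.inr v) : (V ⊕ V) ⊕ Fin 4) ∈ E} ∪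
        (fun v : Fin 4 => (Sum.inr v : (V ⊕ V) ⊕ Fin 4)) ''
          {v : Fin 4 | (Sum.inr v : (V ⊕ V) ⊕ Fin 4) ∈ E} := by
      ext ((v | v) | v) <;> simp
    rw [hdec, card3]
    have sub : ∀ T : Finset (Fin 4), (∀ v ∈ T, (Sum.inr v : (V ⊕ V) ⊕ Fin 4) ∈ E) →
        T.card ≤ {v : Fin 4 | (Sum.inr v : (V ⊕ V) ⊕ Fin 4) ∈ E}.ncard := by
      intro T hT
      rw [← Set.ncard_coe_finset]
      exact Set.ncard_le_ncard fun v hv => hT v hv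
    by_cases m3 : (Sum.inr 3 : (V ⊕ V) ⊕ Fin 4) ∈ E
    · by_cases m0 : (Sum.inr 0 : (V ⊕ V) ⊕ Fin 4) ∈ E
      · by_cases m1 : (Sum.inr 1 : (V ⊕ V) ⊕ Fin 4) ∈ E
        · have := sub {0, 1, 3} (by simp [m0, m1, m3])
          rw [show ({0, 1, 3} : Finset (Fin 4)).card = 3 from rfl] at this
          omega
        · have := sub {0, 3} (by simp [m0, m3])
          rw [show ({0, 3} : Finset (Fin 4)).card = 2 from rfl] at this
          have := hY2 m1
          omega
      · have := hX2 m0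
        by_cases m1 : (Sum.inr 1 : (V ⊕ V) ⊕ Fin 4) ∈ E
        · have := sub {1, 3} (by simp [m1, m3])
          rw [show ({1, 3} : Finset (Fin 4)).card = 2 from rfl] at this
          omega
        · have := hY2 m1
          omega
    · have := hX1 m3
      have := hY1 m3
      omega
  · refine ⟨_, ?_, (card3 D D {2}).trans ?_, ?_⟩
    · rintro ((v | v) | v) hv
      · obtain ⟨u, hu, ha⟩ := hD v (by simpa using hv)
        exact ⟨Sum.inl (Sum.inl u), by simpa using hu, by simp [F2graph, ha, ha.ne]⟩
      · obtain ⟨u, hu, ha⟩ := hD v (by simpa using hv)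
        exact ⟨Sum.inl (Sum.inr u), by simpa using hu, by simp [F2graph, ha, ha.ne]⟩
      · refine ⟨Sum.inr 2, by simp, ?_⟩
        fin_cases v <;> simp [F2graph] at hv ⊢
    · rw [Set.ncard_singleton]; omega
    · rw [Set.disjoint_left]
      rintro ((v | v) | v) hv <;> simp at hv ⊢
      subst hv; decide

theorem subset_pair_of_ncard_le_two {α : Type*} [Finite α] [Nonempty α] {D : Set α}
    (h2 : D.ncard ≤ 2) : ∃ a b : α, D ⊆ {a, b} := by
  rcases Nat.lt_or_ge D.ncard 2 with h | h
  · obtain ⟨a, ha⟩ := (Set.ncard_le_one_iff_subset_singleton (s := D)).1 (by omega)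
    exact ⟨a, a, by simpa using ha⟩
  · obtain ⟨a, b, -, hab⟩ := Set.ncard_eq_two.1 (le_antisymm h2 h)
    exact ⟨a, b, hab.le⟩

theorem A_pair {r : Fin 8} (key : ∀ a b : Fin 8, ∃ v : Fin 8, v ≠ r ∧ v ≠ a ∧ v ≠ b ∧
      ¬ graphA.Adj a v ∧ ¬ graphA.Adj b v) (D : Set (Fin 8))
    (hD : ∀ v, v ∉ D → v ≠ r → ∃ u ∈ D, graphA.Adj u v) : 3 ≤ D.ncard := by
  by_contra hlt
  obtain ⟨a, b, hab⟩ := subset_pair_of_ncard_le_two (D := D) (by omega)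
  obtain ⟨v, nr, na, nb, aa, ab⟩ := key a b
  obtain ⟨u, hu, hadj⟩ := hD v (fun hv => by
    rcases hab hv with h | h
    · exact na h
    · exact nb h) nr
  rcases hab hu with h | h
  · exact aa (h ▸ hadj)
  · exact ab (h ▸ hadj)

set_option synthInstance.maxSize 10000 in
set_option synthInstance.maxHeartbeats 400000 in
set_option maxRecDepth 100000 in
theorem A_inv : WeakInv graphA 6 7 3 := by
  refine ⟨?_, A_pair ?_, A_pair ?_, {0, 1, 3}, ?_, ?_⟩
  · intro D hD
    by_contra hlt
    have key : ∀ a : Fin 8, ∃ v : Fin 8, v ≠ 6 ∧ v ≠ 7 ∧ v ≠ a ∧ ¬ graphA.Adj a v := by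
      simp only [graphA, SimpleGraph.fromEdgeSet_adj, Set.mem_insert_iff, Set.mem_singleton_iff]
      decide
    obtain ⟨a, ha⟩ := (Set.ncard_le_one_iff_subset_singleton (s := D)).1 (by omega)
    obtain ⟨v, n6, n7, na, aa⟩ := key a
    obtain ⟨u, hu, hadj⟩ := hD v (fun hv => na (ha hv)) n6 n7
    exact aa ((ha hu : u = a) ▸ hadj)
  · simp only [graphA, SimpleGraph.fromEdgeSet_adj, Set.mem_insert_iff, Set.mem_singleton_iff]
    decide
  · simp only [graphA, SimpleGraph.fromEdgeSet_adj, Set.mem_insert_iff, Set.mem_singleton_iff]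
    decide
  · simp only [IsDomSet, graphA, SimpleGraph.fromEdgeSet_adj, Set.mem_insert_iff,
      Set.mem_singleton_iff]
    decide
  · rw [Set.ncard_eq_three]
    exact ⟨0, 1, 3, by decide, by decide, by decide, rfl⟩

theorem VPt_finite_card (i : ℕ) :
    Finite (VPt (i + 1)) ∧ Nat.card (VPt (i + 1)) + 4 = 3 * 2 ^ (i + 3) := by
  induction i with
  | zero =>
    refine ⟨inferInstanceAs (Finite ((Fin 8 ⊕ Fin 8) ⊕ Fin 4)), ?_⟩
    change Nat.card ((Fin 8 ⊕ Fin 8) ⊕ Fin 4) + 4 = _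
    simp
  | succ i ih =>
    obtain ⟨hf, hc⟩ := ih
    refine ⟨inferInstanceAs (Finite ((VPt (i + 1) ⊕ VPt (i + 1)) ⊕ Fin 4)), ?_⟩
    change Nat.card ((VPt (i + 1) ⊕ VPt (i + 1)) ⊕ Fin 4) + 4 = _
    rw [Nat.card_sum, Nat.card_sum, Nat.card_fin]
    have : 2 ^ (i + 1 + 3) = 2 * 2 ^ (i + 3) := by ring
    omega

theorem P_inv (i : ℕ) :
    DomInv (Pgraphs (i + 1)) (proot1 (i + 1)) (proot2 (i + 1))
      {proot1 (i + 1), proot2 (i + 1)} (2 ^ (i + 3) - 1) := by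
  induction i with
  | zero => exact F2_inv A_inv
  | succ i ih =>
    have := (VPt_finite_card i).1
    have h := F2_inv ih.weak
    have e : 2 * (2 ^ (i + 3) - 1) + 1 = 2 ^ (i + 1 + 3) - 1 := by
      have : 2 ^ (i + 1 + 3) = 2 * 2 ^ (i + 3) := by ring
      have : 0 < 2 ^ (i + 3) := by positivity
      omega
    rw [e] at h
    exact h

/-- For every `i ≥ 1`:
(a) `γ(P^{i+1}) = 2·γ(P^i) + 1` and `γ(P^i − V) = γ(P^i)` for every `V ⊆ {p1^i, p2^i}`;
(b) `P^i` has `3·2^{i+2} − 4` vertices and `γ(P^i) = 2^{i+2} − 1`. -/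
theorem stmt_11 (i : ℕ) (hi : 1 ≤ i) :
    domNum (Pgraphs (i + 1)) = 2 * domNum (Pgraphs i) + 1 ∧
    (∀ V : Set (VPt i), V ⊆ {proot1 i, proot2 i} →
      domNum ((Pgraphs i).induce Vᶜ) = domNum (Pgraphs i)) ∧
    Nat.card (VPt i) = 3 * 2 ^ (i + 2) - 4 ∧
    domNum (Pgraphs i) = 2 ^ (i + 2) - 1 := by
  obtain ⟨i, rfl⟩ : ∃ j, i = j + 1 := ⟨i - 1, by omega⟩
  have h0 := domNum_eq_of_inv (P_inv i)
  have h1 := domNum_eq_of_inv (P_inv (i + 1))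
  refine ⟨?_, ?_, ?_, h0⟩
  · rw [h0, h1]
    have : 2 ^ (i + 1 + 3) = 2 * 2 ^ (i + 3) := by ring
    have : 0 < 2 ^ (i + 3) := by positivity
    omega
  · intro S hS
    rw [h0]
    exact domNum_induce_of_inv (P_inv i) S hS
  · have := (VPt_finite_card i).2
    have e : i + 1 + 2 = i + 3 := rfl
    rw [e]
    omega
end

section
/- Let G be a finite simple cubic graph with n vertices and let G[B] be obtained from G by replacing every vertex of G by a disjoint copy of (B, {b1,b2,b3}). Then G[B] is a cubic graph with 9n vertices, γ(G[B]) = 3n (so γ(G[B]) = v(G[B])/3), and if G is connected then G[B] is connected. -/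
open SimpleGraph

/-- The roots `b1 = 6`, `b2 = 7`, `b3 = 8` of the graph `B`. -/
def broot (j : Fin 3) : Fin 9 := ⟨6 + j.val, by omega⟩

/-- The graph `G[B]`, obtained from a cubic graph `G` by replacing every vertex by a disjoint
copy of `(B, {b1, b2, b3})`.  For adjacent vertices `u, v` of `G`, the function `port` chooses
which of the three roots of the copy of `B` at `u` is joined to the copy of `B` at `v`. -/
def GBgraph {V : Type*} (G : SimpleGraph V) (port : V → V → Fin 3) :
    SimpleGraph (V × Fin 9) :=
  SimpleGraph.fromRel (fun a b =>
    (a.1 = b.1 ∧ graphB.Adj a.2 b.2) ∨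
    (G.Adj a.1 b.1 ∧ a.2 = broot (port a.1 b.1) ∧ b.2 = broot (port b.1 a.1)))


instance instDecGraphB : DecidableRel graphB.Adj := fun a b => by
  unfold graphB
  simp only [SimpleGraph.fromEdgeSet_adj, Set.mem_insert_iff, Set.mem_singleton_iff]
  infer_instance

theorem GB_adj {V : Type*} (G : SimpleGraph V) (port : V → V → Fin 3) (a b : V × Fin 9) :
    (GBgraph G port).Adj a b ↔ (a.1 = b.1 ∧ graphB.Adj a.2 b.2) ∨
    (G.Adj a.1 b.1 ∧ a.2 = broot (port a.1 b.1) ∧ b.2 = broot (port b.1 a.1)) := by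
  unfold GBgraph
  rw [SimpleGraph.fromRel_adj]
  constructor
  · rintro ⟨_, h | h⟩
    · exact h
    · rcases h with ⟨h1, h2⟩ | ⟨h1, h2, h3⟩
      · exact Or.inl ⟨h1.symm, h2.symm⟩
      · exact Or.inr ⟨h1.symm, h3, h2⟩
  · intro h
    refine ⟨?_, Or.inl h⟩
    rintro rfl
    rcases h with h | h
    · exact graphB.loopless.irrefl _ h.2
    · exact G.loopless.irrefl _ h.1

theorem port_ex {V : Type*} (G : SimpleGraph V) (hcub : IsCubic G)
    (port : V → V → Fin 3) (hport : ∀ v : V, Set.InjOn (port v) (G.neighborSet v))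
    (v : V) (j : Fin 3) : ∃ w, G.Adj v w ∧ port v w = j := by
  have hc : Nat.card (G.neighborSet v) = 3 := hcub v
  have hf : Finite (G.neighborSet v) := Nat.finite_of_card_ne_zero (by omega)
  have hb : Function.Bijective (fun x : G.neighborSet v => port v x) := by
    rw [Nat.bijective_iff_injective_and_card]
    refine ⟨fun a b h => Subtype.ext (hport v a.2 b.2 h), by simp [hc]⟩
  obtain ⟨w, hw⟩ := hb.2 j
  exact ⟨w.1, w.2, hw⟩

theorem broot_inj {a b : Fin 3} (h : broot a = broot b) : a = b := by
  revert a b; decide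

theorem small_nbr : ∀ i : Fin 9, i.val < 6 →
    (Finset.univ.filter (fun j => graphB.Adj i j)).card = 3 := by decide

theorem root_nbr : ∀ j : Fin 3,
    (Finset.univ.filter (fun k => graphB.Adj (broot j) k)).card = 2 := by decide

theorem root_cases : ∀ i : Fin 9, i.val < 6 ∨ ∃ j, i = broot j := by decide

theorem broot_ge (j : Fin 3) : ¬ (broot j).val < 6 := by simp [broot]

theorem GB_cubic {V : Type*} (G : SimpleGraph V) (hcub : IsCubic G)
    (port : V → V → Fin 3) (hport : ∀ v : V, Set.InjOn (port v) (G.neighborSet v)) :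
    IsCubic (GBgraph G port) := by
  classical
  rintro ⟨v, i⟩
  rw [Nat.card_coe_set_eq]
  have inj : Function.Injective (fun j : Fin 9 => (v, j)) := fun a b h => by simpa using h
  rcases root_cases i with hi | ⟨j, rfl⟩
  · have : (GBgraph G port).neighborSet (v, i) =
        (((Finset.univ.filter (fun j => graphB.Adj i j)).image (fun j => (v, j)) :
          Finset (V × Fin 9)) : Set (V × Fin 9)) := by
      ext ⟨w, k⟩
      rw [SimpleGraph.mem_neighborSet, GB_adj]
      simp only [Finset.coe_image, Finset.coe_filter, Finset.mem_univ, true_and,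
        Set.mem_image, Set.mem_setOf_eq, Prod.mk.injEq]
      constructor
      · rintro (⟨h1, h2⟩ | ⟨_, h, _⟩)
        · exact ⟨k, h2, h1, rfl⟩
        · rw [h] at hi
          exact absurd hi (broot_ge _)
      · rintro ⟨k', h, h1, rfl⟩
        exact Or.inl ⟨h1, h⟩
    rw [this, Set.ncard_coe_finset, Finset.card_image_of_injective _ inj, small_nbr i hi]
  · obtain ⟨u, hu, hj⟩ := port_ex G hcub port hport v j
    have : (GBgraph G port).neighborSet (v, broot j) =
        ((insert (u, broot (port u v))
          ((Finset.univ.filter (fun k => graphB.Adj (broot j) k)).image (fun j => (v, j))) :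
          Finset (V × Fin 9)) : Set (V × Fin 9)) := by
      ext ⟨w, k⟩
      rw [SimpleGraph.mem_neighborSet, GB_adj]
      simp only [Finset.coe_insert, Finset.coe_image, Finset.coe_filter, Finset.mem_univ,
        true_and, Set.mem_image, Set.mem_setOf_eq, Prod.mk.injEq, Set.mem_insert_iff]
      constructor
      · rintro (⟨h1, h2⟩ | ⟨h1, h2, h3⟩)
        · exact Or.inr ⟨k, h2, h1, rfl⟩
        · have : u = w := hport v hu h1 (by rw [hj]; exact broot_inj h2)
          subst this
          exact Or.inl ⟨rfl, h3⟩
      · rintro (⟨rfl, rfl⟩ | ⟨k', h, h1, rfl⟩)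
        · exact Or.inr ⟨hu, by rw [hj], rfl⟩
        · exact Or.inl ⟨h1, h⟩
    rw [this, Set.ncard_coe_finset, Finset.card_insert_of_notMem,
      Finset.card_image_of_injective _ inj, root_nbr j]
    intro h
    simp only [Finset.mem_image, Prod.mk.injEq] at h
    obtain ⟨_, _, h, _⟩ := h
    exact hu.ne h

theorem two_not_dom : ∀ a b : Fin 9, ∃ i : Fin 9, i.val < 6 ∧ i ≠ a ∧ i ≠ b ∧
    ¬ graphB.Adj a i ∧ ¬ graphB.Adj b i := by decide

theorem sub_pair (S : Finset (Fin 9)) (h : S.card < 3) : ∃ a b, S ⊆ {a, b} := by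
  have : S.card = 0 ∨ S.card = 1 ∨ S.card = 2 := by omega
  rcases this with h | h | h
  · rw [Finset.card_eq_zero] at h
    exact ⟨0, 0, by simp [h]⟩
  · obtain ⟨a, rfl⟩ := Finset.card_eq_one.1 h
    exact ⟨a, a, by simp⟩
  · obtain ⟨a, b, _, rfl⟩ := Finset.card_eq_two.1 h
    exact ⟨a, b, subset_rfl⟩

theorem dom_lower {V : Type*} [Fintype V] (G : SimpleGraph V)
    (port : V → V → Fin 3) (D : Set (V × Fin 9)) (hD : IsDomSet (GBgraph G port) D) :
    3 * Fintype.card V ≤ D.ncard := by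
  classical
  rw [Set.ncard_eq_toFinset_card',
    Finset.card_eq_sum_card_fiberwise (f := Prod.fst) (t := Finset.univ) (by simp)]
  have key : ∀ v ∈ (Finset.univ : Finset V),
      3 ≤ (D.toFinset.filter (fun p => p.1 = v)).card := by
    intro v _
    by_contra hlt
    obtain ⟨a, b, hab⟩ := sub_pair ((D.toFinset.filter (fun p => p.1 = v)).image Prod.snd)
      (lt_of_le_of_lt Finset.card_image_le (by omega))
    have hmem : ∀ k, (v, k) ∈ D → k = a ∨ k = b := by
      intro k hk
      have : k ∈ ({a, b} : Finset (Fin 9)) := hab (Finset.mem_image.2 ⟨(v, k), by simp [hk], rfl⟩)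
      simpa using this
    obtain ⟨i, hi, ha, hb, hna, hnb⟩ := two_not_dom a b
    obtain ⟨⟨w, k⟩, hk, hadj⟩ := hD (v, i) (fun h => by
      rcases hmem i h with h | h
      · exact ha h
      · exact hb h)
    rw [GB_adj] at hadj
    rcases hadj with ⟨h1, h2⟩ | ⟨_, _, h⟩
    · simp only at h1 h2
      subst h1
      rcases hmem k hk with rfl | rfl
      · exact hna h2
      · exact hnb h2
    · simp only at h
      rw [h] at hi
      exact broot_ge _ hi
  have := Finset.card_nsmul_le_sum _ _ 3 key
  simp only [Finset.card_univ, smul_eq_mul] at this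
  omega

theorem three_dom : ∀ i : Fin 9, i ∉ ({0, 1, 3} : Finset (Fin 9)) →
    ∃ k ∈ ({0, 1, 3} : Finset (Fin 9)), graphB.Adj k i := by decide

theorem GB_domNum {V : Type*} [Fintype V] (G : SimpleGraph V)
    (port : V → V → Fin 3) : domNum (GBgraph G port) = 3 * Fintype.card V := by
  classical
  have hmem : 3 * Fintype.card V ∈
      {n : ℕ | ∃ D : Set (V × Fin 9), IsDomSet (GBgraph G port) D ∧ D.ncard = n} := by
    refine ⟨(((Finset.univ : Finset V) ×ˢ ({0, 1, 3} : Finset (Fin 9)) : Finset (V × Fin 9)) :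
      Set (V × Fin 9)), ?_, ?_⟩
    · rintro ⟨v, i⟩ hv
      obtain ⟨k, hk, hadj⟩ := three_dom i (fun h => hv (by
        rw [Finset.mem_coe, Finset.mem_product]
        exact ⟨Finset.mem_univ _, h⟩))
      refine ⟨(v, k), ?_, (GB_adj _ _ _ _).2 (Or.inl ⟨rfl, hadj⟩)⟩
      rw [Finset.mem_coe, Finset.mem_product]
      exact ⟨Finset.mem_univ _, hk⟩
    · rw [Set.ncard_coe_finset, Finset.card_product, Finset.card_univ, mul_comm]
      rfl
  apply le_antisymm
  · exact Nat.sInf_le hmem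
  · apply le_csInf ⟨_, hmem⟩
    rintro m ⟨D, hD, rfl⟩
    exact dom_lower G port D hD

theorem B_reach : ∀ i : Fin 9, i = 0 ∨ graphB.Adj i 0 ∨ (∃ k, graphB.Adj i k ∧ graphB.Adj k 0) ∨
    ∃ k l, graphB.Adj i k ∧ graphB.Adj k l ∧ graphB.Adj l 0 := by decide

theorem GB_conn {V : Type*} (G : SimpleGraph V) (port : V → V → Fin 3)
    (hG : G.Connected) : (GBgraph G port).Connected := by
  have hin : ∀ v i j, graphB.Adj i j → (GBgraph G port).Reachable (v, i) (v, j) :=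
    fun v i j h => SimpleGraph.Adj.reachable ((GB_adj _ _ _ _).2 (Or.inl ⟨rfl, h⟩))
  have h0 : ∀ v i, (GBgraph G port).Reachable (v, i) (v, 0) := by
    intro v i
    rcases B_reach i with rfl | h | ⟨k, h1, h2⟩ | ⟨k, l, h1, h2, h3⟩
    · exact SimpleGraph.Reachable.refl _
    · exact hin _ _ _ h
    · exact (hin _ _ _ h1).trans (hin _ _ _ h2)
    · exact ((hin _ _ _ h1).trans (hin _ _ _ h2)).trans (hin _ _ _ h3)
  have hw : ∀ v w, G.Walk v w → (GBgraph G port).Reachable (v, 0) (w, 0) := by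
    intro v w p
    induction p with
    | nil => exact SimpleGraph.Reachable.refl _
    | @cons a b c h p ih =>
      have : (GBgraph G port).Adj (a, broot (port a b)) (b, broot (port b a)) :=
        (GB_adj _ _ _ _).2 (Or.inr ⟨h, rfl, rfl⟩)
      exact (((h0 _ _).symm.trans this.reachable).trans (h0 _ _)).trans ih
  haveI := hG.nonempty
  refine ⟨?_⟩
  rintro ⟨v, i⟩ ⟨w, j⟩
  obtain ⟨p⟩ := hG.preconnected v w
  exact ((h0 v i).trans (hw v w p)).trans (h0 w j).symm

/-- Let `G` be a finite simple cubic graph with `n` vertices and let `G[B]`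
be obtained from `G` by replacing every vertex of `G` by a disjoint copy of `(B, {b1,b2,b3})`
(the roots at each vertex being matched injectively—hence bijectively—with its three
neighbours).  Then `G[B]` is a cubic graph with `9n` vertices, `γ(G[B]) = 3n`
(so `γ(G[B]) = v(G[B])/3`), and if `G` is connected then `G[B]` is connected. -/
theorem stmt_13 {V : Type*} [Fintype V] (G : SimpleGraph V) (n : ℕ)
    (hcard : Fintype.card V = n) (hcub : IsCubic G)
    (port : V → V → Fin 3)
    (hport : ∀ v : V, Set.InjOn (port v) (G.neighborSet v)) :
    IsCubic (GBgraph G port) ∧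
    Nat.card (V × Fin 9) = 9 * n ∧
    domNum (GBgraph G port) = 3 * n ∧
    (G.Connected → (GBgraph G port).Connected) := by
  subst hcard
  refine ⟨GB_cubic G hcub port hport, ?_, GB_domNum G port, GB_conn G port⟩
  rw [Nat.card_prod, Nat.card_eq_fintype_card, Nat.card_eq_fintype_card, Fintype.card_fin, mul_comm]
end

section
/- Let D be the graph obtained from two disjoint copies (B', {b'1, b'2, b'3}) and (B'', {b''1, b''2, b''3}) of (B, {b1, b2, b3}) by adding the three edges b'1b''1, b'2b''2, b'3b''3. Then D is a cubic graph with 18 vertices, γ(D) = 6 = ⌈18/3⌉, and D is 3-connected: deleting any set of at most 2 vertices leaves D connected. -/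
open SimpleGraph

/-- The graph `D`, obtained from two disjoint copies `(B', {b'1,b'2,b'3})` and
`(B'', {b''1,b''2,b''3})` of `(B, {b1,b2,b3})` by adding the three edges
`b'1b''1`, `b'2b''2`, `b'3b''3`. -/
def graphD : SimpleGraph (Fin 9 ⊕ Fin 9) :=
  SimpleGraph.fromRel (fun a b =>
    (∃ x y, graphB.Adj x y ∧ a = Sum.inl x ∧ b = Sum.inl y) ∨
    (∃ x y, graphB.Adj x y ∧ a = Sum.inr x ∧ b = Sum.inr y) ∨
    (∃ j : Fin 3, a = Sum.inl (broot j) ∧ b = Sum.inr (broot j)))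

abbrev VD := Fin 9 ⊕ Fin 9

/-- Computable adjacency of `graphB`, one direction. -/
def adjBB (x y : Fin 9) : Bool :=
  match x.val with
  | 0 => Nat.testBit 448 y.val
  | 1 => Nat.testBit 56 y.val
  | 2 => Nat.testBit 56 y.val
  | 3 => Nat.testBit 70 y.val
  | 4 => Nat.testBit 134 y.val
  | 5 => Nat.testBit 262 y.val
  | 6 => Nat.testBit 9 y.val
  | 7 => Nat.testBit 17 y.val
  | _ => Nat.testBit 33 y.val

/-- Computable adjacency of `graphD`. -/
def adjDB : VD → VD → Bool
  | .inl x, .inl y => adjBB x y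
  | .inr x, .inr y => adjBB x y
  | .inl x, .inr y => Nat.beq x.val y.val && Nat.ble 6 x.val
  | .inr x, .inl y => Nat.beq x.val y.val && Nat.ble 6 x.val

theorem adjBB_iff (x y : Fin 9) : graphB.Adj x y ↔ adjBB x y = true := by
  simp only [graphB, SimpleGraph.fromEdgeSet_adj, Set.mem_insert_iff, Set.mem_singleton_iff]
  revert x y
  decide +kernel

theorem adjDB_iff (a b : VD) : graphD.Adj a b ↔ adjDB a b = true := by
  have hs : ∀ x y : Fin 9, adjBB x y = adjBB y x := by decide +kernel
  have hi : ∀ x : Fin 9, adjBB x x = false := by decide +kernel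
  have hr : ∀ x y : Fin 9, (∃ j : Fin 3, x = broot j ∧ y = broot j) ↔
      (Nat.beq x.val y.val && Nat.ble 6 x.val) = true := by decide +kernel
  have hr2 : ∀ x y : Fin 9, (∃ j : Fin 3, y = broot j ∧ x = broot j) ↔
      (Nat.beq x.val y.val && Nat.ble 6 x.val) = true := by decide +kernel
  rcases a with x | x <;> rcases b with y | y
  · simp only [graphD, SimpleGraph.fromRel_adj, adjBB_iff, adjDB]
    constructor
    · rintro ⟨-, (⟨p, q, h, h1, h2⟩ | ⟨p, q, h, h1, h2⟩ | ⟨j, h1, h2⟩) |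
        (⟨p, q, h, h1, h2⟩ | ⟨p, q, h, h1, h2⟩ | ⟨j, h1, h2⟩)⟩ <;> simp_all
    · intro h
      refine ⟨?_, Or.inl (Or.inl ⟨x, y, h, rfl, rfl⟩)⟩
      intro e
      simp_all
  · simp only [graphD, SimpleGraph.fromRel_adj, adjDB, ← hr]
    simp
  · simp only [graphD, SimpleGraph.fromRel_adj, adjDB, ← hr2]
    simp
  · simp only [graphD, SimpleGraph.fromRel_adj, adjBB_iff, adjDB]
    constructor
    · rintro ⟨-, (⟨p, q, h, h1, h2⟩ | ⟨p, q, h, h1, h2⟩ | ⟨j, h1, h2⟩) |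
        (⟨p, q, h, h1, h2⟩ | ⟨p, q, h, h1, h2⟩ | ⟨j, h1, h2⟩)⟩ <;> simp_all
    · intro h
      refine ⟨?_, Or.inl (Or.inr (Or.inl ⟨x, y, h, rfl, rfl⟩))⟩
      intro e
      simp_all

instance : DecidableRel graphD.Adj := fun a b => decidable_of_iff _ (adjDB_iff a b).symm

theorem cubicD : IsCubic graphD := by
  intro v
  rw [Nat.card_eq_fintype_card, SimpleGraph.card_neighborSet_eq_degree]
  revert v
  decide +kernel

def vlist : List VD := (List.finRange 9).map Sum.inl ++ (List.finRange 9).map Sum.inr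

theorem mem_vlist (v : VD) : v ∈ vlist := by
  rcases v with v | v <;> simp [vlist]

/-- `u` dominates `v`. -/
def domB (u v : VD) : Bool := decide (u = v) || adjDB u v

/-- Branching search: `L` cannot be extended by at most `n` vertices to a dominating set. -/
def search : ℕ → List VD → Bool
  | n, L =>
    match vlist.find? (fun v => !(L.any (fun u => domB u v))) with
    | none => false
    | some v =>
      match n with
      | 0 => true
      | n + 1 => (vlist.filter (fun u => domB u v)).all (fun u => search n (u :: L))

theorem search_sound (S : Finset VD) (hS : IsDomSet graphD (S : Set VD)) :
    ∀ (n : ℕ) (L : List VD), search n L = true → L.Nodup → (∀ x ∈ L, x ∈ S) →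
      L.length + n < S.card := by
  have key : ∀ (L : List VD) (v : VD), L.Nodup → (∀ x ∈ L, x ∈ S) →
      (!(L.any (fun u => domB u v))) = true →
      ∃ u, domB u v = true ∧ (u :: L).Nodup ∧ (∀ x ∈ u :: L, x ∈ S) := by
    intro L v hL hLS hv
    have hu : ∃ u ∈ S, domB u v = true := by
      by_cases h : v ∈ S
      · exact ⟨v, h, by simp [domB]⟩
      · obtain ⟨u, hu, ha⟩ := hS v (by simpa using h)
        exact ⟨u, by simpa using hu, by simp [domB, (adjDB_iff u v).1 ha]⟩
    obtain ⟨u, hu, hd⟩ := hu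
    refine ⟨u, hd, ?_, ?_⟩
    · refine List.nodup_cons.2 ⟨fun hm => ?_, hL⟩
      simp only [Bool.not_eq_true', List.any_eq_false] at hv
      exact hv u hm hd
    · intro x hx
      rcases List.mem_cons.1 hx with rfl | hx
      · exact hu
      · exact hLS x hx
  intro n
  induction n with
  | zero =>
    intro L h hL hLS
    unfold search at h
    split at h
    · cases h
    · rename_i v hf
      obtain ⟨u, -, hn, hs⟩ := key L v hL hLS (by have h9 := List.find?_some hf; exact h9)
      have := Finset.card_le_card (s := (u :: L).toFinset) (t := S)
        (fun x hx => hs x (List.mem_toFinset.1 hx))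
      rw [List.toFinset_card_of_nodup hn] at this
      simp at this
      omega
  | succ n ih =>
    intro L h hL hLS
    unfold search at h
    split at h
    · cases h
    · rename_i v hf
      obtain ⟨u, hd, hn, hs⟩ := key L v hL hLS (by have h9 := List.find?_some hf; exact h9)
      have h' := List.all_eq_true.1 h u (List.mem_filter.2 ⟨mem_vlist u, hd⟩)
      have := ih (u :: L) h' hn hs
      simp at this
      omega

theorem search_five : search 5 [] = true := by decide +kernel

theorem domNumD : domNum graphD = 6 := by
  apply le_antisymm
  · apply Nat.sInf_le
    refine ⟨(({.inl 0, .inl 1, .inl 2, .inr 0, .inr 1, .inr 2} : Finset VD) : Set VD), ?_, ?_⟩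
    · have : ∀ v : VD, v ∉ ({.inl 0, .inl 1, .inl 2, .inr 0, .inr 1, .inr 2} : Finset VD) →
        ∃ u ∈ ({.inl 0, .inl 1, .inl 2, .inr 0, .inr 1, .inr 2} : Finset VD),
          graphD.Adj u v := by decide +kernel
      exact this
    · rw [Set.ncard_coe_finset]
      decide +kernel
  · apply le_csInf
    · exact ⟨_, Set.univ, fun v hv => absurd (Set.mem_univ v) hv, rfl⟩
    · rintro n ⟨D, hD, rfl⟩
      have hf : (D.toFinite.toFinset : Set VD) = D := by simp
      have := search_sound D.toFinite.toFinset (by rw [hf]; exact hD) 5 [] search_five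
        List.nodup_nil (by simp)
      rw [← Set.ncard_coe_finset, hf] at this
      simp at this
      omega

def memB (x : VD) (L : List VD) : Bool := L.any (fun y => decide (x = y))

theorem memB_iff (x : VD) (L : List VD) : memB x L = true ↔ x ∈ L := by
  simp [memB]

/-- One step of exploration in the graph with the vertices of `F` deleted. -/
def grow (F : List VD) (L : List VD) : List VD :=
  vlist.filter (fun x => !(memB x F) && (L.any (fun y => domB y x)))

def iter (F : List VD) : ℕ → List VD → List VD
  | 0, L => L
  | n + 1, L => iter F n (grow F L)

/-- Check that deleting `F` leaves a connected graph. -/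
def connB (F : List VD) : Bool :=
  match vlist.find? (fun x => !(memB x F)) with
  | none => false
  | some r =>
    let L := iter F 9 [r]
    vlist.all (fun x => memB x F || memB x L)

theorem connB_sound (F : List VD) (U : Set VD) (hU : ∀ x, x ∈ U ↔ x ∈ F) (h : connB F = true) :
    (graphD.induce Uᶜ).Connected := by
  unfold connB at h
  split at h
  · cases h
  · rename_i r hr
    have hr' : r ∈ Uᶜ := by
      have := List.find?_some hr
      simpa [memB_iff, ← Bool.not_eq_true, hU] using this
    have inv : ∀ (n : ℕ) (L : List VD),
        (∀ x ∈ L, ∃ hx : x ∈ Uᶜ, (graphD.induce Uᶜ).Reachable ⟨r, hr'⟩ ⟨x, hx⟩) →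
        (∀ x ∈ iter F n L, ∃ hx : x ∈ Uᶜ, (graphD.induce Uᶜ).Reachable ⟨r, hr'⟩ ⟨x, hx⟩) := by
      intro n
      induction n with
      | zero => intro L hL; exact hL
      | succ n ih =>
        intro L hL
        apply ih
        intro x hx
        simp only [grow, List.mem_filter, Bool.and_eq_true, List.any_eq_true] at hx
        obtain ⟨-, hxF, y, hy, hd⟩ := hx
        have hxU : x ∈ Uᶜ := by simpa [memB_iff, ← Bool.not_eq_true, hU] using hxF
        obtain ⟨hyU, hreach⟩ := hL y hy
        refine ⟨hxU, ?_⟩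
        simp only [domB, Bool.or_eq_true, decide_eq_true_eq] at hd
        rcases hd with rfl | hd
        · exact hreach
        · refine hreach.trans (SimpleGraph.Adj.reachable ?_)
          exact (adjDB_iff y x).2 hd
    have all : ∀ x : (Uᶜ : Set VD), (graphD.induce Uᶜ).Reachable ⟨r, hr'⟩ x := by
      rintro ⟨x, hx⟩
      have hm := List.all_eq_true.1 h x (mem_vlist x)
      have hxF : x ∉ F := fun hh => hx ((hU x).2 hh)
      have hxL : x ∈ iter F 9 [r] := by simpa [memB_iff, ← Bool.not_eq_true, hxF] using hm
      obtain ⟨_, h2⟩ := inv 9 [r] (by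
        intro y hy
        obtain rfl := List.mem_singleton.1 hy
        exact ⟨hr', SimpleGraph.Reachable.refl _⟩) x hxL
      exact h2
    have : Nonempty (Uᶜ : Set VD) := ⟨⟨r, hr'⟩⟩
    exact ⟨fun x y => (all x).symm.trans (all y)⟩

theorem conn_empty : connB [] = true := by decide +kernel

theorem conn_pairs : vlist.all (fun a => vlist.all (fun b => connB [a, b])) = true := by
  decide +kernel

theorem connD (U : Set VD) (h : U.ncard ≤ 2) : (graphD.induce Uᶜ).Connected := by
  have hp : ∀ a b, connB [a, b] = true := fun a b =>
    List.all_eq_true.1 (List.all_eq_true.1 conn_pairs a (mem_vlist a)) b (mem_vlist b)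
  have h3 : U.ncard = 0 ∨ U.ncard = 1 ∨ U.ncard = 2 := by omega
  rcases h3 with h | h | h
  · have : U = ∅ := (Set.ncard_eq_zero U.toFinite).1 h
    exact connB_sound [] U (by simp [this]) conn_empty
  · obtain ⟨a, rfl⟩ := Set.ncard_eq_one.1 h
    exact connB_sound [a, a] _ (by simp) (hp a a)
  · obtain ⟨a, b, -, rfl⟩ := Set.ncard_eq_two.1 h
    exact connB_sound [a, b] _ (by simp) (hp a b)

/-- The graph `D` is cubic with 18 vertices, `γ(D) = 6 = ⌈18/3⌉`, and `D` is
3-connected: deleting any set of at most 2 vertices leaves `D` connected. -/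
theorem stmt_14 :
    IsCubic graphD ∧
    Fintype.card (Fin 9 ⊕ Fin 9) = 18 ∧
    domNum graphD = 6 ∧
    (6 : ℕ) = ⌈(18 : ℚ) / 3⌉₊ ∧
    ∀ U : Set (Fin 9 ⊕ Fin 9), U.ncard ≤ 2 → (graphD.induce Uᶜ).Connected := by
  refine ⟨cubicD, by simp, domNumD, ?_, connD⟩
  have : ((18 : ℚ) / 3) = ((6 : ℕ) : ℚ) := by norm_num
  rw [this, Nat.ceil_natCast]
end
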